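/- arXiv:0807.3603 — 2 statements merged into one kernel-verified Lean document; each statement's English description precedes it below -/
import Mathlib

section
/- Let τ be in the complex upper half-plane, set q = e^{2πiτ}, and let u ∈ ℂ with u ∉ 2ℤτ + (1/2)ℤ, z = e^{2πiu}. Then N*(0,1/q,z;q²) = −i μ(2u, τ; 4τ) − i e^{−2πiτ} z μ(2u, 3τ; 4τ) + 1. -/
open Complex Real Filter

noncomputable section

/-- The Jacobi theta function ϑ(u;τ) = Σ_{ν∈ℤ+1/2} e^{πiν²τ + 2πiν(u+1/2)}. -/
def jTheta (u τ : ℂ) : ℂ :=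
  ∑' n : ℤ, Complex.exp (π * I * ((n : ℂ) + 1/2)^2 * τ + 2 * π * I * ((n : ℂ) + 1/2) * (u + 1/2))

/-- ϑ₀(u;τ) = Σ_{n∈ℤ} e^{πin²τ + 2πinu}. -/
def jTheta0 (u τ : ℂ) : ℂ :=
  ∑' n : ℤ, Complex.exp (π * I * (n : ℂ)^2 * τ + 2 * π * I * (n : ℂ) * u)

/-- ϑ₁(u;τ) = Σ_{n∈1/2+ℤ} e^{πin²τ + 2πinu}. -/
def jTheta1 (u τ : ℂ) : ℂ :=
  ∑' n : ℤ, Complex.exp (π * I * ((n : ℂ) + 1/2)^2 * τ + 2 * π * I * ((n : ℂ) + 1/2) * u)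

/-- The Dedekind eta function. -/
def dedekindEta (τ : ℂ) : ℂ :=
  Complex.exp (π * I * τ / 12) * ∏' n : ℕ, (1 - Complex.exp (2 * π * I * ((n : ℂ) + 1) * τ))

/-- The Lerch sum μ(u,v;τ). -/
def lerchMu (u v τ : ℂ) : ℂ :=
  Complex.exp (π * I * u) / jTheta v τ *
    ∑' n : ℤ, (-1 : ℂ) ^ n * Complex.exp (π * I * ((n : ℂ)^2 + (n : ℂ)) * τ + 2 * π * I * v * (n : ℂ)) /
      (1 - Complex.exp (2 * π * I * (n : ℂ) * τ + 2 * π * I * u))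

/-- a₀^{α,β}(τ). -/
def aCoef0 (α β : ℝ) (τ : ℂ) : ℂ :=
  ∑' n : ℤ, ((n : ℂ) + (α : ℂ)/2) *
    Complex.exp (2 * π * I * (n : ℂ)^2 * τ + 2 * π * I * (n : ℂ) * ((α : ℂ) * τ + (β : ℂ)))

/-- a₁^{α,β}(τ). -/
def aCoef1 (α β : ℝ) (τ : ℂ) : ℂ :=
  ∑' n : ℤ, (((n : ℂ) + 1/2) + (α : ℂ)/2) *
    Complex.exp (2 * π * I * ((n : ℂ) + 1/2)^2 * τ + 2 * π * I * ((n : ℂ) + 1/2) * ((α : ℂ) * τ + (β : ℂ)))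

/-- Finite q-Pochhammer symbol (a;q)_n. -/
def qPochN (a q : ℂ) (n : ℕ) : ℂ := ∏ j ∈ Finset.range n, (1 - a * q ^ j)

/-- Infinite q-Pochhammer symbol (a;q)_∞. -/
def qPochInf (a q : ℂ) : ℂ := ∏' j : ℕ, (1 - a * q ^ j)

/-- The modified rank generating function R*(z;q). -/
def rankStar (z q : ℂ) : ℂ :=
  (qPochInf q q)⁻¹ * ∑' n : ℤ, (-1 : ℂ) ^ n * q ^ (n * (3 * n + 1) / 2) / (1 - z * q ^ n)

/-- The modified crank generating function C*(z;q). -/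
def crankStar (z q : ℂ) : ℂ :=
  (1 - z)⁻¹ * ∏' n : ℕ, ((1 - q ^ (n + 1)) / ((1 - z * q ^ (n + 1)) * (1 - z⁻¹ * q ^ (n + 1))))

/-- N(1,0,z;q), the overpartition-rank generating function. -/
def nGen10 (z q : ℂ) : ℂ :=
  ∑' n : ℕ, qPochN (-1) q n * q ^ (n * (n + 1) / 2) / (qPochN (z * q) q n * qPochN (z⁻¹ * q) q n)

/-- N*(1,0,z;q). -/
def nStar10 (z q : ℂ) : ℂ := nGen10 z q / (1 - z)

/-- N(1,1/q,z;q²), the M2-rank generating function for overpartitions. -/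
def nGenM2over (z q : ℂ) : ℂ :=
  ∑' n : ℕ, qPochN (-1) (q^2) n * qPochN (-q) (q^2) n * q ^ n /
    (qPochN (z * q^2) (q^2) n * qPochN (z⁻¹ * q^2) (q^2) n)

/-- N*(1,1/q,z;q²). -/
def nStarM2over (z q : ℂ) : ℂ := nGenM2over z q / (1 - z)

/-- N(0,1/q,z;q²), the M2-rank generating function for partitions without repeated odd parts. -/
def nGenM2 (z q : ℂ) : ℂ :=
  ∑' n : ℕ, qPochN (-q) (q^2) n * q ^ (n^2) /
    (qPochN (z * q^2) (q^2) n * qPochN (z⁻¹ * q^2) (q^2) n)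

/-- N*(0,1/q,z;q²). -/
def nStarM2 (z q : ℂ) : ℂ := nGenM2 z q / (1 - z)

/-- The odd-rank generating function R^o(z;q). -/
def oddRank (z q : ℂ) : ℂ :=
  (qPochInf (q^2) (q^2))⁻¹ * ∑' n : ℤ, (-1 : ℂ) ^ n * q ^ (3 * n^2 + 3 * n + 1) / (1 - z * q ^ (2 * n + 1))

/-- The reciprocal `1 / (Q;Q)_m`, extended by zero to negative `m`. -/
def invPoch (Q : ℂ) (m : ℤ) : ℂ := if m < 0 then 0 else (qPochN Q Q m.toNat)⁻¹

lemma qPochN_succ (a q : ℂ) (n : ℕ) : qPochN a q (n + 1) = qPochN a q n * (1 - a * q ^ n) :=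
  Finset.prod_range_succ _ _

lemma one_sub_ne_zero_of_norm_lt_one {x : ℂ} (hx : ‖x‖ < 1) : 1 - x ≠ 0 := by
  intro h
  have : x = 1 := (sub_eq_zero.mp h).symm
  simp [this] at hx

lemma invPoch_of_neg (Q : ℂ) {m : ℤ} (hm : m < 0) : invPoch Q m = 0 := if_pos hm

lemma invPoch_natCast (Q : ℂ) (m : ℕ) : invPoch Q m = (qPochN Q Q m)⁻¹ := by
  simp [invPoch]

lemma invPoch_zero (Q : ℂ) : invPoch Q 0 = 1 := by
  simp [invPoch, qPochN]

lemma invPoch_sub_one {Q : ℂ} (hQ : ‖Q‖ < 1) (m : ℤ) :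
    invPoch Q (m - 1) = (1 - Q ^ m) * invPoch Q m := by
  rcases lt_trichotomy m 0 with hm | rfl | hm
  · rw [invPoch_of_neg Q hm, invPoch_of_neg Q (by omega), mul_zero]
  · simp [invPoch_of_neg]
  · obtain ⟨k, rfl⟩ : ∃ k : ℕ, m = k + 1 := ⟨(m - 1).toNat, by omega⟩
    have h : 1 - Q ^ (k + 1) ≠ 0 := one_sub_ne_zero_of_norm_lt_one
      (by simpa using pow_lt_one₀ (norm_nonneg Q) hQ (Nat.succ_ne_zero k))
    rw [add_sub_cancel_right, ← Nat.cast_succ, invPoch_natCast, invPoch_natCast, zpow_natCast,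
      Nat.succ_eq_add_one, qPochN_succ, ← pow_succ', mul_inv]
    field_simp

lemma norm_invPoch_le {Q : ℂ} (hQ : ‖Q‖ < 1) (m : ℕ) :
    ‖invPoch Q m‖ ≤ ((1 - ‖Q‖)⁻¹) ^ m := by
  rw [invPoch_natCast, qPochN, norm_inv, norm_prod, inv_pow]
  have h0 : 0 < 1 - ‖Q‖ := sub_pos.mpr hQ
  gcongr
  rw [← Finset.card_range m, ← Finset.prod_const, Finset.card_range]
  refine Finset.prod_le_prod (fun _ _ => h0.le) fun j _ => ?_
  calc 1 - ‖Q‖ ≤ 1 - ‖Q * Q ^ j‖ := by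
        rw [norm_mul, norm_pow]
        gcongr
        exact mul_le_of_le_one_right (norm_nonneg _) (pow_le_one₀ (norm_nonneg _) hQ.le)
    _ ≤ ‖1 - Q * Q ^ j‖ := by simpa using norm_sub_norm_le 1 (Q * Q ^ j)

lemma norm_invPoch_mul_le {Q : ℂ} (hQ : ‖Q‖ < 1) (n : ℕ) (r : ℤ) :
    ‖invPoch Q (n - r) * invPoch Q (n + r)‖ ≤ (((1 - ‖Q‖)⁻¹) ^ 2) ^ n := by
  have h0 : 0 < 1 - ‖Q‖ := sub_pos.mpr hQ
  by_cases h : 0 ≤ n - r ∧ 0 ≤ n + r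
  · obtain ⟨a, ha⟩ := Int.eq_ofNat_of_zero_le h.1
    obtain ⟨b, hb⟩ := Int.eq_ofNat_of_zero_le h.2
    rw [ha, hb, norm_mul, ← pow_mul, show 2 * n = a + b by omega, pow_add]
    gcongr <;> exact norm_invPoch_le hQ _
  · have : invPoch Q (n - r) * invPoch Q (n + r) = 0 := by
      rw [not_and_or] at h
      rcases h with h | h <;> rw [invPoch_of_neg Q (not_le.mp h)] <;> simp
    rw [this, norm_zero]
    positivity

lemma summable_invPoch_mul (Q : ℂ) (n : ℕ) (f : ℤ → ℂ) :
    Summable fun r : ℤ => invPoch Q (n - r) * invPoch Q (n + r) * f r := by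
  refine summable_of_ne_finset_zero (s := Finset.Icc (-n : ℤ) n) fun r hr => ?_
  rw [Finset.mem_Icc, not_and_or] at hr
  rcases hr with h | h
  · rw [invPoch_of_neg Q (show (n : ℤ) + r < 0 by omega)]; simp
  · rw [invPoch_of_neg Q (show (n : ℤ) - r < 0 by omega)]; simp

lemma summable_pow_mul_pow_sq {D ρ : ℝ} (hD : 0 < D) (h0 : 0 < ρ) (h1 : ρ < 1) :
    Summable fun n : ℕ => D ^ n * ρ ^ n ^ 2 := by
  refine summable_of_ratio_test_tendsto_lt_one (l := 0) one_pos
    (Eventually.of_forall fun n => by positivity) ?_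
  have h : Tendsto (fun n : ℕ => D * ρ * (ρ ^ 2) ^ n) atTop (nhds 0) := by
    simpa using (tendsto_pow_atTop_nhds_zero_of_lt_one (by positivity)
      (pow_lt_one₀ h0.le h1 two_ne_zero)).const_mul (D * ρ)
  refine h.congr fun n => ?_
  rw [norm_of_nonneg (by positivity), norm_of_nonneg (by positivity)]
  field_simp
  ring

lemma summable_zpow_mul_zpow_sq {D ρ : ℝ} (hD : 0 < D) (h0 : 0 < ρ) (h1 : ρ < 1) :
    Summable fun n : ℤ => D ^ n * ρ ^ n ^ 2 := by
  refine Summable.of_nat_of_neg ?_ ?_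
  · exact_mod_cast summable_pow_mul_pow_sq hD h0 h1
  · have := summable_pow_mul_pow_sq (inv_pos.mpr hD) h0 h1
    simp only [even_two.neg_pow, zpow_neg, ← inv_zpow]
    exact_mod_cast this

lemma summable_norm_zpow_mul {q : ℂ} (h0 : q ≠ 0) (h1 : ‖q‖ < 1) (a : ℕ) (ha : a ≠ 0) (b : ℤ)
    {w : ℤ → ℂ} {C : ℝ} (hw : ∀ r, ‖w r‖ ≤ C) :
    Summable fun r : ℤ => ‖q ^ (a * r ^ 2 + b * r) * w r‖ := by
  have h := (summable_zpow_mul_zpow_sq (zpow_pos (norm_pos_iff.mpr h0) b)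
    (pow_pos (norm_pos_iff.mpr h0) a) (pow_lt_one₀ (norm_nonneg _) h1 ha)).mul_right C
  refine h.of_nonneg_of_le (fun r => norm_nonneg _) fun r => ?_
  rw [norm_mul, norm_zpow, zpow_add₀ (norm_ne_zero_iff.mpr h0), zpow_mul, zpow_mul, zpow_natCast,
    mul_comm (_ ^ _ : ℝ)]
  gcongr
  exact hw r

lemma tsum_int_shift_sub {H : ℤ → ℂ} (hH : Summable H) : ∑' r, (H (r + 1) - H r) = 0 := by
  have h1 : Summable fun r => H (r + 1) := (Equiv.addRight (1 : ℤ)).summable_iff.mpr hH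
  rw [h1.tsum_sub hH, sub_eq_zero]
  exact (Equiv.addRight (1 : ℤ)).tsum_eq H

lemma norm_sq_lt_one {q : ℂ} (h1 : ‖q‖ < 1) : ‖q ^ 2‖ < 1 := by
  rw [norm_pow]
  exact pow_lt_one₀ (norm_nonneg _) h1 two_ne_zero

lemma tsum_invPoch_mul_neg (Q : ℂ) (n : ℕ) (f : ℤ → ℂ) :
    ∑' r : ℤ, invPoch Q (n - r) * invPoch Q (n + r) * f (-r)
      = ∑' r : ℤ, invPoch Q (n - r) * invPoch Q (n + r) * f r := by
  rw [← (Equiv.neg ℤ).tsum_eq fun r : ℤ => invPoch Q (n - r) * invPoch Q (n + r) * f r]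
  refine tsum_congr fun r => ?_
  rw [Equiv.neg_apply, sub_neg_eq_add, ← sub_eq_add_neg, mul_comm (invPoch Q (n - r))]

lemma neg_one_zpow_mul_zpow_reflect {q : ℂ} (h0 : q ≠ 0) (r : ℤ) :
    (-1) ^ r * q ^ (r ^ 2 + r) = (q ^ 2) ^ r * ((-1) ^ (-r) * q ^ ((-r) ^ 2 + -r)) := by
  rw [zpow_neg, ← inv_zpow, ← zpow_natCast q 2, ← zpow_mul, mul_left_comm, ← zpow_add₀ h0]
  norm_num
  left
  ring_nf

/-- The case `n ≥ 1` of the finite Gauss sum `∑ (-1)^r q^(r²+r) / ((q²;q²)_{n-r} (q²;q²)_{n+r})`. -/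
lemma tsum_invPoch_mul_eq_zero {q : ℂ} (h0 : q ≠ 0) (h1 : ‖q‖ < 1) {n : ℕ} (hn : n ≠ 0) :
    ∑' r : ℤ, invPoch (q ^ 2) (n - r) * invPoch (q ^ 2) (n + r) *
      ((-1) ^ r * q ^ (r ^ 2 + r)) = 0 := by
  have hQ := norm_sq_lt_one h1
  set c : ℤ → ℂ := fun r => (-1) ^ r * q ^ (r ^ 2 + r) with hc
  set E : ℤ → ℂ := fun r => invPoch (q ^ 2) (n - r) * invPoch (q ^ 2) (n + r) with hE
  have hne : 1 - (q ^ 2) ^ n ≠ 0 := one_sub_ne_zero_of_norm_lt_one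
    (by simpa only [norm_pow] using pow_lt_one₀ (norm_nonneg _) hQ hn)
  have key := tsum_int_shift_sub (summable_invPoch_mul (q ^ 2) n
    fun r => (1 - (q ^ 2) ^ (n + r)) * c (-r))
  have hstep : ∀ r : ℤ,
      invPoch (q ^ 2) (n - (r + 1)) * invPoch (q ^ 2) (n + (r + 1)) *
          ((1 - (q ^ 2) ^ (n + (r + 1))) * c (-(r + 1)))
        - invPoch (q ^ 2) (n - r) * invPoch (q ^ 2) (n + r) *
          ((1 - (q ^ 2) ^ (n + r)) * c (-r))
      = -(1 - (q ^ 2) ^ n) * (E r * c r + E r * c (-r)) := by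
    intro r
    have e1 := invPoch_sub_one hQ (n - r)
    have e2 := invPoch_sub_one hQ (n + (r + 1))
    rw [show (n : ℤ) + (r + 1) - 1 = n + r by ring] at e2
    rw [show (n : ℤ) - (r + 1) = n - r - 1 by ring, ← mul_assoc, mul_assoc (invPoch _ (n - r - 1)),
      mul_comm (invPoch _ (n + (r + 1))), ← e2, e1]
    have hcr : c (-(r + 1)) = -c r := by
      simp only [hc]
      rw [zpow_neg, zpow_add_one₀ (by norm_num), show (-(r + 1)) ^ 2 + -(r + 1) = r ^ 2 + r by ring,
        mul_inv, ← inv_zpow]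
      norm_num
    rw [hcr, show c r = (q ^ 2) ^ r * c (-r) from neg_one_zpow_mul_zpow_reflect h0 r]
    simp only [hE]
    have hq2 : q ^ 2 ≠ 0 := pow_ne_zero 2 h0
    have hr : (q ^ 2) ^ r ≠ 0 := zpow_ne_zero _ hq2
    rw [zpow_sub₀ hq2, zpow_add₀ hq2, zpow_natCast]
    generalize (q ^ 2) ^ r = x at hr ⊢
    field_simp
    ring
  rw [tsum_congr hstep, tsum_mul_left, (summable_invPoch_mul _ n c).tsum_add
    (summable_invPoch_mul _ n fun r => c (-r)), tsum_invPoch_mul_neg (q ^ 2) n c] at key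
  rcases mul_eq_zero.mp key with h | h
  · exact absurd (neg_eq_zero.mp h) hne
  · exact add_self_eq_zero.mp h

lemma tsum_invPoch_mul_zero (Q : ℂ) (f : ℤ → ℂ) :
    ∑' r : ℤ, invPoch Q ((0 : ℕ) - r) * invPoch Q ((0 : ℕ) + r) * f r = f 0 := by
  rw [tsum_eq_single 0]
  · simp [invPoch_zero]
  · intro r hr
    rcases lt_or_gt_of_ne hr with h | h
    · rw [invPoch_of_neg Q (show ((0 : ℕ) : ℤ) + r < 0 by simpa using h)]; simp
    · rw [invPoch_of_neg Q (show ((0 : ℕ) : ℤ) - r < 0 by simpa using h)]; simp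

/-- Partial fraction expansion of `1 / ((z;q²)_{n+1} (q²/z;q²)_n)`. -/
lemma tsum_invPoch_mul_eq_inv {q z : ℂ} (h0 : q ≠ 0) (h1 : ‖q‖ < 1) (hz0 : z ≠ 0)
    (hz : ∀ m : ℤ, 1 - z * (q ^ 2) ^ m ≠ 0) (n : ℕ) :
    ∑' r : ℤ, invPoch (q ^ 2) (n - r) * invPoch (q ^ 2) (n + r) *
      ((-1) ^ r * q ^ (r ^ 2 + r) * (1 - z * (q ^ 2) ^ r)⁻¹)
    = ((1 - z) * (qPochN (z * q ^ 2) (q ^ 2) n * qPochN (z⁻¹ * q ^ 2) (q ^ 2) n))⁻¹ := by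
  have hQ := norm_sq_lt_one h1
  have hq2 : q ^ 2 ≠ 0 := pow_ne_zero 2 h0
  set c : ℤ → ℂ := fun r => (-1) ^ r * q ^ (r ^ 2 + r) with hc
  induction n with
  | zero =>
    rw [tsum_invPoch_mul_zero]
    simp [qPochN]
  | succ n ih =>
    have hT := tsum_invPoch_mul_eq_zero h0 h1 (Nat.succ_ne_zero n)
    have hT' := tsum_invPoch_mul_neg (q ^ 2) (n + 1) c
    set x := (q ^ 2) ^ (n + 1) with hx
    have hstep : ∀ r : ℤ, invPoch (q ^ 2) (n - r) * invPoch (q ^ 2) (n + r) *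
        (c r * (1 - z * (q ^ 2) ^ r)⁻¹) =
        (1 - z * x) * (1 - z⁻¹ * x) * (invPoch (q ^ 2) ((n + 1 : ℕ) - r) *
          invPoch (q ^ 2) ((n + 1 : ℕ) + r) * (c r * (1 - z * (q ^ 2) ^ r)⁻¹))
        + (-x * (invPoch (q ^ 2) ((n + 1 : ℕ) - r) *
          invPoch (q ^ 2) ((n + 1 : ℕ) + r) * c (-r))
        + x * z⁻¹ * (invPoch (q ^ 2) ((n + 1 : ℕ) - r) *
          invPoch (q ^ 2) ((n + 1 : ℕ) + r) * c r)) := by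
      intro r
      have e1 := invPoch_sub_one hQ ((n + 1 : ℕ) - r)
      have e2 := invPoch_sub_one hQ ((n + 1 : ℕ) + r)
      rw [show ((n + 1 : ℕ) : ℤ) - r - 1 = n - r by push_cast; ring] at e1
      rw [show ((n + 1 : ℕ) : ℤ) + r - 1 = n + r by push_cast; ring] at e2
      have hcr' : c r = (q ^ 2) ^ r * c (-r) := neg_one_zpow_mul_zpow_reflect h0 r
      rw [e1, e2, hcr', zpow_sub₀ hq2, zpow_add₀ hq2, zpow_natCast, ← hx]
      have hr : (q ^ 2) ^ r ≠ 0 := zpow_ne_zero _ hq2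
      have hzr := hz r
      generalize (q ^ 2) ^ r = y at hr hzr ⊢
      have hzr' : 1 - y * z ≠ 0 := by rwa [mul_comm]
      field_simp
      ring
    have s1 := summable_invPoch_mul (q ^ 2) (n + 1) fun r => c r * (1 - z * (q ^ 2) ^ r)⁻¹
    have s2 := summable_invPoch_mul (q ^ 2) (n + 1) fun r => c (-r)
    have s3 := summable_invPoch_mul (q ^ 2) (n + 1) c
    rw [tsum_congr hstep, (s1.mul_left _).tsum_add ((s2.mul_left _).add (s3.mul_left _)),
      (s2.mul_left _).tsum_add (s3.mul_left _), tsum_mul_left, tsum_mul_left, tsum_mul_left, hT',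
      hT] at ih
    have f1 : 1 - z * x ≠ 0 := by
      simpa only [hx, zpow_natCast] using hz (n + 1 : ℕ)
    have f2 : 1 - z⁻¹ * x ≠ 0 := by
      have := hz (-(n + 1 : ℕ))
      rw [zpow_neg, zpow_natCast, ← hx] at this
      have hx0 : x ≠ 0 := pow_ne_zero _ hq2
      intro h
      apply this
      field_simp at h ⊢
      linear_combination -h
    rw [qPochN_succ, qPochN_succ, mul_assoc z, mul_assoc z⁻¹, ← pow_succ', ← hx]
    rw [mul_zero, mul_zero, add_zero, add_zero] at ih
    rw [show ∀ a b d : ℂ, (1 - z) * (a * (1 - z * x) * (b * (1 - z⁻¹ * x))) =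
      (1 - z * x) * (1 - z⁻¹ * x) * ((1 - z) * (a * b)) from fun a b d => by ring,
      mul_inv, ← ih, inv_mul_cancel_left₀ (mul_ne_zero f1 f2)]
    exact 0

lemma norm_qPochN_neg_le {q : ℂ} (h1 : ‖q‖ < 1) (n : ℕ) : ‖qPochN (-q) (q ^ 2) n‖ ≤ 2 ^ n := by
  rw [qPochN, norm_prod, ← Finset.card_range n, ← Finset.prod_const, Finset.card_range]
  refine Finset.prod_le_prod (fun _ _ => norm_nonneg _) fun j _ => ?_
  calc ‖1 - -q * (q ^ 2) ^ j‖ ≤ ‖(1 : ℂ)‖ + ‖-q * (q ^ 2) ^ j‖ := norm_sub_le _ _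
    _ ≤ 1 + 1 := by
      rw [norm_one, norm_mul, norm_neg, norm_pow]
      gcongr
      exact mul_le_one₀ h1.le (by positivity)
        (pow_le_one₀ (norm_nonneg _) (norm_sq_lt_one h1).le)
    _ = 2 := by norm_num

/-- The term `(-q;q²)_n q^(n²) / ((q²;q²)_{n-r} (q²;q²)_{n+r})`. -/
def gaussTerm (q : ℂ) (r : ℤ) (n : ℕ) : ℂ :=
  qPochN (-q) (q ^ 2) n * q ^ n ^ 2 * (invPoch (q ^ 2) (n - r) * invPoch (q ^ 2) (n + r))

lemma norm_gaussTerm_le {q : ℂ} (h1 : ‖q‖ < 1) (r : ℤ) (n : ℕ) :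
    ‖gaussTerm q r n‖ ≤ (2 * ((1 - ‖q ^ 2‖)⁻¹) ^ 2) ^ n * ‖q‖ ^ n ^ 2 := by
  rw [gaussTerm, norm_mul, norm_mul, norm_pow, mul_pow, mul_right_comm]
  gcongr
  · exact norm_qPochN_neg_le h1 n
  · exact norm_invPoch_mul_le (norm_sq_lt_one h1) n r

lemma summable_gaussTerm_bound {q : ℂ} (h0 : q ≠ 0) (h1 : ‖q‖ < 1) :
    Summable fun n : ℕ => (2 * ((1 - ‖q ^ 2‖)⁻¹) ^ 2) ^ n * ‖q‖ ^ n ^ 2 := by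
  have := sub_pos.mpr (norm_sq_lt_one h1)
  exact summable_pow_mul_pow_sq (by positivity) (norm_pos_iff.mpr h0) h1

lemma summable_gaussTerm {q : ℂ} (h0 : q ≠ 0) (h1 : ‖q‖ < 1) (r : ℤ) :
    Summable (gaussTerm q r) :=
  (summable_gaussTerm_bound h0 h1).of_norm_bounded fun n => norm_gaussTerm_le h1 r n

lemma summable_mul_gaussTerm {q : ℂ} (h0 : q ≠ 0) (h1 : ‖q‖ < 1) (r : ℤ) (b : ℂ) :
    Summable fun n : ℕ => (1 - (q ^ 2) ^ n * b) * gaussTerm q r n := by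
  refine ((summable_gaussTerm_bound h0 h1).mul_left (1 + ‖b‖)).of_norm_bounded fun n => ?_
  rw [norm_mul]
  gcongr
  · refine (norm_sub_le _ _).trans ?_
    rw [norm_one, norm_mul, norm_pow]
    gcongr
    exact mul_le_of_le_one_left (norm_nonneg _)
      (pow_le_one₀ (norm_nonneg _) (norm_sq_lt_one h1).le)
  · exact norm_gaussTerm_le h1 r n

lemma tsum_gaussTerm_add_one {q : ℂ} (h0 : q ≠ 0) (h1 : ‖q‖ < 1) (r : ℤ) :
    ∑' n, gaussTerm q (r + 1) n = q ^ (2 * r + 1) * ∑' n, gaussTerm q r n := by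
  have hQ := norm_sq_lt_one h1
  have hq2 : q ^ 2 ≠ 0 := pow_ne_zero 2 h0
  set s := q ^ (2 * r + 1) with hs
  have hsr : s = (q ^ 2) ^ r * q := by
    rw [hs, zpow_add_one₀ h0, zpow_mul]
    norm_cast
  set G : ℕ → ℂ := fun n => (1 - s) * (qPochN (-q) (q ^ 2) n * q ^ n ^ 2 *
    (invPoch (q ^ 2) (n - r - 1) * invPoch (q ^ 2) (n + r))) with hG
  have hGs : Summable G := by
    refine ((summable_mul_gaussTerm h0 h1 r ((q ^ 2) ^ (-r))).mul_left (1 - s)).congr fun n => ?_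
    simp only [hG, gaussTerm]
    rw [invPoch_sub_one hQ, sub_eq_add_neg (n : ℤ) r, zpow_add₀ hq2, zpow_natCast]
    ring
  have hG0 : G 0 = 0 := by
    have : invPoch (q ^ 2) (-r - 1) * invPoch (q ^ 2) r = 0 := by
      rcases lt_or_ge r 0 with h | h
      · rw [invPoch_of_neg _ h, mul_zero]
      · rw [invPoch_of_neg _ (show -r - 1 < 0 by omega), zero_mul]
    simp [hG, this]
  have hstep : ∀ n : ℕ, s * gaussTerm q r n - gaussTerm q (r + 1) n = G (n + 1) - G n := by
    intro n
    have e1 := invPoch_sub_one hQ (n - r)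
    have e2 := invPoch_sub_one hQ (n + r + 1)
    rw [add_sub_cancel_right] at e2
    simp only [hG, gaussTerm]
    rw [show ((n + 1 : ℕ) : ℤ) - r - 1 = n - r by push_cast; ring,
      show ((n + 1 : ℕ) : ℤ) + r = n + r + 1 by push_cast; ring,
      show (n : ℤ) - (r + 1) = n - r - 1 by ring, show (n : ℤ) + (r + 1) = n + r + 1 by ring,
      e1, e2, zpow_add_one₀ hq2, zpow_sub₀ hq2, zpow_add₀ hq2, zpow_natCast, qPochN_succ,
      show q ^ (n + 1) ^ 2 = q ^ n ^ 2 * (q ^ 2) ^ n * q by ring, hsr]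
    have hr : (q ^ 2) ^ r ≠ 0 := zpow_ne_zero _ hq2
    generalize (q ^ 2) ^ r = x at hr ⊢
    field_simp
    ring
  have htel : ∑' n, (G (n + 1) - G n) = 0 := by
    have h := hGs.tsum_eq_zero_add
    rw [hG0, zero_add] at h
    rw [((summable_nat_add_iff 1).mpr hGs).tsum_sub hGs, h, sub_self]
  rw [← tsum_congr hstep, ((summable_gaussTerm h0 h1 r).mul_left s).tsum_sub
    (summable_gaussTerm h0 h1 (r + 1)), tsum_mul_left] at htel
  exact (sub_eq_zero.mp htel).symm

lemma tsum_gaussTerm {q : ℂ} (h0 : q ≠ 0) (h1 : ‖q‖ < 1) (r : ℤ) :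
    ∑' n, gaussTerm q r n = q ^ r ^ 2 * ∑' n, gaussTerm q 0 n := by
  induction r using Int.induction_on with
  | zero => simp
  | succ k ih =>
    rw [tsum_gaussTerm_add_one h0 h1, ih, ← mul_assoc, ← zpow_add₀ h0]
    ring_nf
  | pred k ih =>
    have h := tsum_gaussTerm_add_one h0 h1 (-k - 1)
    rw [sub_add_cancel, ih] at h
    refine mul_left_cancel₀ (zpow_ne_zero (2 * (-(k : ℤ) - 1) + 1) h0) ?_
    rw [← h, ← mul_assoc, ← zpow_add₀ h0]
    ring_nf

/-- Bailey's transform for the pair given by the weights `w`. -/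
lemma tsum_bailey {q : ℂ} (h0 : q ≠ 0) (h1 : ‖q‖ < 1) {w : ℤ → ℂ} {C : ℝ}
    (hw : ∀ r, ‖w r‖ ≤ C) :
    ∑' n : ℕ, qPochN (-q) (q ^ 2) n * q ^ n ^ 2 * ∑' r : ℤ, invPoch (q ^ 2) (n - r) *
      invPoch (q ^ 2) (n + r) * ((-1) ^ r * q ^ (r ^ 2 + r) * w r)
    = (∑' n, gaussTerm q 0 n) * ∑' r : ℤ, (-1) ^ r * q ^ (2 * r ^ 2 + r) * w r := by
  have hs : Summable (Function.uncurry fun (n : ℕ) (r : ℤ) =>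
      gaussTerm q r n * ((-1) ^ r * q ^ (r ^ 2 + r) * w r)) := by
    have hc : Summable fun r : ℤ => ‖q ^ (r ^ 2 + r) * w r‖ := by
      simpa using summable_norm_zpow_mul h0 h1 1 one_ne_zero 1 hw
    refine ((summable_gaussTerm_bound h0 h1).mul_of_nonneg hc (fun n => by positivity)
      fun r => norm_nonneg _).of_norm_bounded fun p => ?_
    simp only [Function.uncurry, norm_mul, norm_zpow, norm_neg, norm_one, one_zpow, one_mul]
    gcongr
    exact norm_gaussTerm_le h1 _ _
  calc _ = ∑' (n : ℕ) (r : ℤ), gaussTerm q r n * ((-1) ^ r * q ^ (r ^ 2 + r) * w r) := by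
        refine tsum_congr fun n => ?_
        rw [← tsum_mul_left]
        refine tsum_congr fun r => ?_
        rw [gaussTerm]
        ring
    _ = ∑' (r : ℤ) (n : ℕ), gaussTerm q r n * ((-1) ^ r * q ^ (r ^ 2 + r) * w r) :=
        hs.tsum_comm.symm
    _ = _ := by
        rw [← tsum_mul_left]
        refine tsum_congr fun r => ?_
        rw [tsum_mul_right, tsum_gaussTerm h0 h1 r,
          show 2 * r ^ 2 + r = r ^ 2 + (r ^ 2 + r) by ring, zpow_add₀ h0 (r ^ 2) (r ^ 2 + r)]
        ring

lemma tsum_gaussTerm_zero_mul {q : ℂ} (h0 : q ≠ 0) (h1 : ‖q‖ < 1) :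
    (∑' n, gaussTerm q 0 n) * ∑' r : ℤ, (-1) ^ r * q ^ (2 * r ^ 2 + r) = 1 := by
  have h := tsum_bailey h0 h1 (w := fun _ => 1) (C := 1) fun _ => by simp
  simp only [mul_one] at h
  rw [← h, tsum_eq_single 0]
  · rw [tsum_invPoch_mul_zero]
    simp [qPochN]
  · intro n hn
    rw [tsum_invPoch_mul_eq_zero h0 h1 hn, mul_zero]

lemma exists_norm_inv_one_sub_le {z Q : ℂ} (hQ : ‖Q‖ < 1) (hQ0 : Q ≠ 0) (hz0 : z ≠ 0) :
    ∃ C, ∀ r : ℤ, ‖(1 - z * Q ^ r)⁻¹‖ ≤ C := by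
  have hQn : Tendsto (fun n : ℕ => Q ^ n) atTop (nhds 0) :=
    tendsto_pow_atTop_nhds_zero_of_norm_lt_one hQ
  have h1 : Tendsto (fun n : ℕ => ‖(1 - z * Q ^ n)⁻¹‖) atTop (nhds ‖(1 - z * 0)⁻¹‖) :=
    (((hQn.const_mul z).const_sub 1).inv₀ (by simp)).norm
  have h2 : Tendsto (fun n : ℕ => ‖Q ^ n * (Q ^ n - z)⁻¹‖) atTop (nhds ‖0 * (0 - z)⁻¹‖) :=
    (hQn.mul ((hQn.sub_const z).inv₀ (by simpa using hz0))).norm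
  obtain ⟨C, hC⟩ := h1.bddAbove_range
  obtain ⟨D, hD⟩ := h2.bddAbove_range
  refine ⟨max C D, fun r => ?_⟩
  obtain ⟨n, rfl | rfl⟩ := r.eq_nat_or_neg
  · exact le_max_of_le_left (hC ⟨n, by simp⟩)
  · refine le_max_of_le_right (hD ⟨n, ?_⟩)
    have hn : Q ^ n ≠ 0 := pow_ne_zero n hQ0
    have : 1 - z * Q ^ (-n : ℤ) = (Q ^ n - z) * (Q ^ n)⁻¹ := by
      rw [zpow_neg, zpow_natCast, sub_mul, mul_inv_cancel₀ hn]
    simp only [this, mul_inv, inv_inv, mul_comm]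

lemma nStarM2_eq {q z : ℂ} (h0 : q ≠ 0) (h1 : ‖q‖ < 1) (hz0 : z ≠ 0)
    (hz : ∀ m : ℤ, 1 - z * (q ^ 2) ^ m ≠ 0) :
    nStarM2 z q = (∑' r : ℤ, (-1) ^ r * q ^ (2 * r ^ 2 + r) * (1 - z * (q ^ 2) ^ r)⁻¹) /
      ∑' r : ℤ, (-1) ^ r * q ^ (2 * r ^ 2 + r) := by
  obtain ⟨C, hC⟩ := exists_norm_inv_one_sub_le (norm_sq_lt_one h1) (pow_ne_zero 2 h0) hz0
  have hone := tsum_gaussTerm_zero_mul h0 h1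
  rw [div_eq_mul_inv, ← eq_inv_of_mul_eq_one_left hone, mul_comm, ← tsum_bailey h0 h1 hC, nStarM2,
    nGenM2, ← tsum_div_const]
  refine tsum_congr fun n => ?_
  rw [tsum_invPoch_mul_eq_inv h0 h1 hz0 hz, mul_inv, div_div, div_eq_mul_inv, mul_inv]
  ring

lemma jTheta_odd_mul (τ : ℂ) (j : ℤ) :
    jTheta ((2 * j - 1) * τ) (4 * τ) = I * Complex.exp (2 * π * I * τ) ^ j *
      ∑' n : ℤ, (-1) ^ n * Complex.exp (2 * π * I * τ) ^ (2 * n ^ 2 + (2 * j + 1) * n) := by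
  rw [jTheta, ← tsum_mul_left]
  refine tsum_congr fun n => ?_
  rw [show π * I * ((n : ℂ) + 1 / 2) ^ 2 * (4 * τ) +
      2 * π * I * ((n : ℂ) + 1 / 2) * ((2 * j - 1) * τ + 1 / 2) =
      π / 2 * I + n * (π * I) + ((2 * n ^ 2 + (2 * j + 1) * n + j : ℤ) * (2 * π * I * τ)) by
    push_cast; ring, Complex.exp_add, Complex.exp_add, Complex.exp_pi_div_two_mul_I,
    Complex.exp_int_mul, Complex.exp_int_mul, Complex.exp_pi_mul_I,
    zpow_add₀ (Complex.exp_ne_zero _)]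
  ring

lemma lerchMu_odd_mul (τ u : ℂ) (j : ℤ) :
    lerchMu (2 * u) ((2 * j - 1) * τ) (4 * τ) =
      Complex.exp (2 * π * I * u) / jTheta ((2 * j - 1) * τ) (4 * τ) *
      ∑' n : ℤ, (-1) ^ n * Complex.exp (2 * π * I * τ) ^ (2 * n ^ 2 + (2 * j + 1) * n) *
        (1 - Complex.exp (2 * π * I * u) ^ 2 * (Complex.exp (2 * π * I * τ) ^ 4) ^ n)⁻¹ := by
  rw [lerchMu, show π * I * (2 * u) = 2 * π * I * u by ring]
  congr 1
  refine tsum_congr fun n => ?_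
  rw [div_eq_mul_inv, show π * I * ((n : ℂ) ^ 2 + n) * (4 * τ) + 2 * π * I * ((2 * j - 1) * τ) * n =
      (2 * n ^ 2 + (2 * j + 1) * n : ℤ) * (2 * π * I * τ) by push_cast; ring,
    Complex.exp_int_mul, show 2 * π * I * (n : ℂ) * (4 * τ) + 2 * π * I * (2 * u) =
      (2 : ℕ) * (2 * π * I * u) + n * ((4 : ℕ) * (2 * π * I * τ)) by push_cast; ring,
    Complex.exp_add, Complex.exp_nat_mul, Complex.exp_int_mul, Complex.exp_nat_mul]

lemma tsum_theta_three {q : ℂ} (h0 : q ≠ 0) :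
    ∑' n : ℤ, (-1) ^ n * q ^ (2 * n ^ 2 + 3 * n) =
      -q⁻¹ * ∑' n : ℤ, (-1) ^ n * q ^ (2 * n ^ 2 + n) := by
  rw [← (Equiv.subLeft (-1 : ℤ)).tsum_eq, ← tsum_mul_left]
  refine tsum_congr fun n => ?_
  rw [Equiv.subLeft_apply, show 2 * (-1 - n) ^ 2 + 3 * (-1 - n) = 2 * n ^ 2 + n + -1 by ring,
    zpow_add₀ h0, zpow_neg_one, zpow_sub₀ (by norm_num), zpow_neg_one, div_eq_mul_inv, ← inv_zpow,
    inv_neg_one]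
  ring

lemma tsum_theta_five {q : ℂ} (h0 : q ≠ 0) :
    ∑' n : ℤ, (-1) ^ n * q ^ (2 * n ^ 2 + 5 * n) =
      -(q ^ 3)⁻¹ * ∑' n : ℤ, (-1) ^ n * q ^ (2 * n ^ 2 + n) := by
  rw [← (Equiv.subRight (1 : ℤ)).tsum_eq, ← tsum_mul_left]
  refine tsum_congr fun n => ?_
  rw [Equiv.subRight_apply, show 2 * (n - 1) ^ 2 + 5 * (n - 1) = 2 * n ^ 2 + n + -(3 : ℕ) by
    push_cast; ring, zpow_add₀ h0, zpow_neg, zpow_natCast, zpow_sub_one₀ (by norm_num), inv_neg_one]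
  ring

lemma summable_theta_mul {q : ℂ} (h0 : q ≠ 0) (h1 : ‖q‖ < 1) (b : ℤ) {w : ℤ → ℂ} {C : ℝ}
    (hw : ∀ r, ‖w r‖ ≤ C) : Summable fun r : ℤ => (-1) ^ r * q ^ (2 * r ^ 2 + b * r) * w r := by
  refine (summable_norm_zpow_mul h0 h1 2 two_ne_zero b hw).of_norm_bounded fun r => ?_
  simp

/-- Splitting `1 / (1 - z q^(2n))` over the common denominator `1 - z² q^(4n)`. -/
lemma tsum_theta_inv_eq {q z : ℂ} (h0 : q ≠ 0) (h1 : ‖q‖ < 1) (hz0 : z ≠ 0)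
    (hz : ∀ m : ℤ, 1 - z ^ 2 * (q ^ 4) ^ m ≠ 0) :
    ∑' n : ℤ, (-1) ^ n * q ^ (2 * n ^ 2 + n) * (1 - z * (q ^ 2) ^ n)⁻¹ =
      z * ∑' n : ℤ, (-1) ^ n * q ^ (2 * n ^ 2 + 3 * n) * (1 - z ^ 2 * (q ^ 4) ^ n)⁻¹
      + z ^ 2 * ∑' n : ℤ, (-1) ^ n * q ^ (2 * n ^ 2 + 5 * n) * (1 - z ^ 2 * (q ^ 4) ^ n)⁻¹
      + ∑' n : ℤ, (-1) ^ n * q ^ (2 * n ^ 2 + n) := by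
  have hq4 : ‖q ^ 4‖ < 1 := by
    rw [norm_pow]
    exact pow_lt_one₀ (norm_nonneg _) h1 four_ne_zero
  obtain ⟨C, hC⟩ := exists_norm_inv_one_sub_le hq4 (pow_ne_zero 4 h0) (pow_ne_zero 2 hz0)
  have s3 := summable_theta_mul h0 h1 3 hC
  have s5 := summable_theta_mul h0 h1 5 hC
  have s1 : Summable fun r : ℤ => (-1 : ℂ) ^ r * q ^ (2 * r ^ 2 + r) := by
    simpa using summable_theta_mul h0 h1 1 (w := fun _ => 1) (C := 1) fun _ => by simp
  rw [← tsum_mul_left, ← tsum_mul_left, ← (s3.mul_left z).tsum_add (s5.mul_left (z ^ 2)),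
    ← ((s3.mul_left z).add (s5.mul_left (z ^ 2))).tsum_add s1]
  refine tsum_congr fun n => ?_
  have hy4 : (q ^ 4) ^ n = ((q ^ 2) ^ n) ^ 2 := by
    rw [← zpow_natCast ((q ^ 2) ^ n), zpow_comm, zpow_natCast, ← pow_mul]
  have hy (k : ℤ) : q ^ (2 * n ^ 2 + (2 * k + 1) * n) =
      q ^ (2 * n ^ 2 + n) * ((q ^ 2) ^ n) ^ k := by
    rw [← zpow_natCast q 2, ← zpow_mul, ← zpow_mul, ← zpow_add₀ h0]
    push_cast
    ring_nf
  have h3 := hy 1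
  have h5 := hy 2
  norm_num at h3 h5
  norm_cast at h5
  have hzn := hz n
  rw [hy4] at hzn
  rw [h3, h5, hy4]
  generalize (q ^ 2) ^ n = y at hzn ⊢
  have hf : 1 - z ^ 2 * y ^ 2 = (1 - z * y) * (1 + z * y) := by ring
  rw [hf] at hzn ⊢
  have ha := left_ne_zero_of_mul hzn
  have hb := right_ne_zero_of_mul hzn
  field_simp
  ring

/-- N*(0,1/q,z;q²) in terms of Lerch sums. -/
theorem nStarM2_lerch (τ u : ℂ) (hτ : 0 < τ.im)
    (hu : ∀ m n : ℤ, u ≠ 2 * (m : ℂ) * τ + (n : ℂ) / 2) :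
    nStarM2 (Complex.exp (2 * π * I * u)) (Complex.exp (2 * π * I * τ))
    = -I * lerchMu (2 * u) τ (4 * τ)
      - I * Complex.exp (-2 * π * I * τ) * Complex.exp (2 * π * I * u) *
          lerchMu (2 * u) (3 * τ) (4 * τ)
      + 1 := by
  have hj1 := jTheta_odd_mul τ 1
  have hj2 := jTheta_odd_mul τ 2
  have hl1 := lerchMu_odd_mul τ u 1
  have hl2 := lerchMu_odd_mul τ u 2
  rw [show -2 * π * I * τ = -(2 * π * I * τ) by ring, Complex.exp_neg]
  have h1 : ‖Complex.exp (2 * π * I * τ)‖ < 1 := UpperHalfPlane.norm_exp_two_pi_I_lt_one ⟨τ, hτ⟩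
  have hz : ∀ m : ℤ, 1 - Complex.exp (2 * π * I * u) ^ 2 *
      (Complex.exp (2 * π * I * τ) ^ 4) ^ m ≠ 0 := by
    intro m h
    rw [← Complex.exp_nat_mul, ← Complex.exp_nat_mul, ← Complex.exp_int_mul, ← Complex.exp_add,
      sub_eq_zero, eq_comm, Complex.exp_eq_one_iff] at h
    obtain ⟨n, hn⟩ := h
    refine hu (-m) n (mul_left_cancel₀ (mul_ne_zero two_ne_zero Complex.two_pi_I_ne_zero) ?_)
    push_cast at hn ⊢
    linear_combination hn
  have h0 := Complex.exp_ne_zero (2 * π * I * τ)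
  have hz0 := Complex.exp_ne_zero (2 * π * I * u)
  generalize Complex.exp (2 * π * I * τ) = q at *
  generalize Complex.exp (2 * π * I * u) = z at *
  norm_num at hj1 hj2 hl1 hl2
  have hz' : ∀ m : ℤ, 1 - z * (q ^ 2) ^ m ≠ 0 := by
    intro m h
    apply hz m
    rw [show q ^ 4 = (q ^ 2) ^ 2 by ring, ← zpow_natCast (q ^ 2) 2, zpow_comm, zpow_natCast,
      ← mul_pow, ← sub_eq_zero.mp h]
    norm_num
  have hone := tsum_gaussTerm_zero_mul h0 h1
  rw [tsum_theta_three h0] at hj1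
  rw [tsum_theta_five h0] at hj2
  rw [nStarM2_eq h0 h1 hz0 hz', tsum_theta_inv_eq h0 h1 hz0 hz, hl1, hl2, hj1, hj2]
  have hΘ := right_ne_zero_of_mul_eq_one hone
  generalize (∑' n : ℤ, (-1) ^ n * q ^ (2 * n ^ 2 + n) : ℂ) = Θ at *
  field_simp
  ring

end
end

section
/- Let τ be in the complex upper half-plane and let u ∈ ℂ with u ∉ 2ℤτ + (1/2)ℤ. Then ϑ(u;2τ)³ · (4πi ∂/∂τ + ∂²/∂u²)[ e^{πiu} e^{−πiτ/4} μ(2u, τ; 4τ) + e^{−9πiτ/4} e^{3πiu} μ(2u, 3τ; 4τ) ] = −8π² η(τ) η(2τ)⁵ η(4τ) e^{πiu} e^{πiτ/2} ϑ(u + 1/2 + τ; 2τ), where the differential operator is applied to the bracketed expression as a function of (u,τ). -/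
open Complex Real Filter

noncomputable section

lemma HasSum.of_eq {ι : Type*} {f g : ι → ℂ} {a b : ℂ} (h : HasSum f a) (hf : ∀ n, g n = f n)
    (hab : b = a) : HasSum g b := by
  rw [hab, funext hf]; exact h

/-- The reciprocal `1 / (p; p)_m`, extended by zero to negative `m`. -/
def qPochRecip (p : ℂ) (m : ℤ) : ℂ := if m < 0 then 0 else (qPochN p p m.toNat)⁻¹

lemma one_sub_pow_ne_zero {p : ℂ} (hp : ‖p‖ < 1) (k : ℕ) : 1 - p * p ^ k ≠ 0 := by
  rw [← pow_succ']
  intro h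
  have h1 : ‖p ^ (k + 1)‖ = 1 := by rw [← sub_eq_zero.mp h]; simp
  rw [norm_pow] at h1
  exact (pow_lt_one₀ (norm_nonneg _) hp (Nat.succ_ne_zero k)).ne h1

lemma qPochN_self_ne_zero {p : ℂ} (hp : ‖p‖ < 1) (n : ℕ) : qPochN p p n ≠ 0 :=
  Finset.prod_ne_zero_iff.mpr fun k _ => one_sub_pow_ne_zero hp k

lemma qPochRecip_sub_one {p : ℂ} (hp : ‖p‖ < 1) (m : ℤ) :
    qPochRecip p (m - 1) = (1 - p ^ m) * qPochRecip p m := by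
  rcases lt_trichotomy m 0 with h | rfl | h
  · simp [qPochRecip, h, show m < 1 by omega]
  · simp [qPochRecip]
  · obtain ⟨k, rfl⟩ : ∃ k : ℕ, m = k + 1 := ⟨(m - 1).toNat, by omega⟩
    have h1 : ¬ ((k : ℤ) + 1 < 0) := by omega
    have h2 : ¬ ((k : ℤ) < 0) := by omega
    have h3 : ((k : ℤ) + 1).toNat = k + 1 := by omega
    have h4 := one_sub_pow_ne_zero hp k
    have h5 := qPochN_self_ne_zero hp k
    have h6 : p ^ ((k : ℤ) + 1) = p * p ^ k := by
      rw [← pow_succ']; exact_mod_cast zpow_natCast p (k + 1)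
    simp only [qPochRecip, add_sub_cancel_right, h1, h2, if_false, h3, Int.toNat_natCast,
      qPochN_succ, h6]
    field_simp

lemma hasSum_qBinomial_theta {q x : ℂ} (hq : ‖q‖ < 1) (hq0 : q ≠ 0) (hx : x ≠ 0) (N : ℕ) :
    HasSum (fun n : ℤ => qPochN (q ^ 2) (q ^ 2) (2 * N) * qPochRecip (q ^ 2) (N + n) *
        qPochRecip (q ^ 2) (N - n) * (q ^ (n ^ 2) * x ^ n))
      (qPochN (-(x * q)) (q ^ 2) N * qPochN (-(x⁻¹ * q)) (q ^ 2) N) := by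
  have hp : ‖q ^ 2‖ < 1 := by
    rw [norm_pow]; exact pow_lt_one₀ (norm_nonneg _) hq two_ne_zero
  induction N with
  | zero =>
    have : qPochN (-(x * q)) (q ^ 2) 0 * qPochN (-(x⁻¹ * q)) (q ^ 2) 0 = 1 := by simp [qPochN]
    rw [this]
    convert hasSum_single (0 : ℤ) ?_ using 1
    · simp [qPochN, qPochRecip]
    · intro n hn
      rcases lt_or_gt_of_ne hn with h | h <;> simp [qPochRecip, h]
  | succ N ih =>
    have h1 := ih.mul_left (1 + q ^ (4 * N + 2))
    have h2 := ((Equiv.subRight (1 : ℤ)).hasSum_iff.mpr ih).mul_left (x * q ^ (2 * N + 1))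
    have h3 := ((Equiv.addRight (1 : ℤ)).hasSum_iff.mpr ih).mul_left (x⁻¹ * q ^ (2 * N + 1))
    refine ((h1.add h2).add h3).of_eq (fun n => ?_) ?_
    · simp only [Function.comp, Equiv.subRight_apply, Equiv.coe_addRight]
      set A := qPochRecip (q ^ 2) ((N + 1 : ℕ) + n) with hA
      set B := qPochRecip (q ^ 2) ((N + 1 : ℕ) - n) with hB
      have a1 : qPochRecip (q ^ 2) (N + n) = (1 - (q ^ 2) ^ ((N : ℤ) + 1 + n)) * A := by
        rw [hA, show ((N + 1 : ℕ) : ℤ) + n = N + 1 + n by push_cast; ring,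
          ← qPochRecip_sub_one hp]; congr 1; ring
      have a2 : qPochRecip (q ^ 2) (N + (n - 1)) =
          (1 - (q ^ 2) ^ ((N : ℤ) + n)) * ((1 - (q ^ 2) ^ ((N : ℤ) + 1 + n)) * A) := by
        rw [← a1, ← qPochRecip_sub_one hp]; congr 1; ring
      have b1 : qPochRecip (q ^ 2) (N - n) = (1 - (q ^ 2) ^ ((N : ℤ) + 1 - n)) * B := by
        rw [hB, show ((N + 1 : ℕ) : ℤ) - n = N + 1 - n by push_cast; ring,
          ← qPochRecip_sub_one hp]; congr 1; ring
      have b2 : qPochRecip (q ^ 2) (N - (n + 1)) =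
          (1 - (q ^ 2) ^ ((N : ℤ) - n)) * ((1 - (q ^ 2) ^ ((N : ℤ) + 1 - n)) * B) := by
        rw [← b1, ← qPochRecip_sub_one hp]; congr 1; ring
      have a3 : qPochRecip (q ^ 2) (N + (n + 1)) = A := by
        rw [hA]; congr 1; push_cast; ring
      have b3 : qPochRecip (q ^ 2) (N - (n - 1)) = B := by
        rw [hB]; congr 1; push_cast; ring
      rw [a1, a2, b1, b2, a3, b3, show 2 * (N + 1) = 2 * N + 1 + 1 by ring, qPochN_succ,
        qPochN_succ]
      have e1 : q ^ ((n - 1) ^ 2) = q ^ (n ^ 2) * (q ^ n)⁻¹ ^ 2 * q := by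
        rw [show (n - 1) ^ 2 = n ^ 2 + (-n) * 2 + 1 by ring, zpow_add₀ hq0, zpow_add₀ hq0,
          zpow_mul, zpow_neg, zpow_one]; norm_cast
      have e2 : q ^ ((n + 1) ^ 2) = q ^ (n ^ 2) * (q ^ n) ^ 2 * q := by
        rw [show (n + 1) ^ 2 = n ^ 2 + n * 2 + 1 by ring, zpow_add₀ hq0, zpow_add₀ hq0,
          zpow_mul, zpow_one]; norm_cast
      have e3 : x ^ (n - 1) = x ^ n * x⁻¹ := by rw [zpow_sub_one₀ hx]
      have e4 : x ^ (n + 1) = x ^ n * x := by rw [zpow_add_one₀ hx]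
      have hp0 : q ^ 2 ≠ 0 := pow_ne_zero _ hq0
      have hn : (q ^ 2) ^ n = (q ^ n) ^ 2 := by
        rw [← zpow_natCast (q ^ n), ← zpow_natCast q, ← zpow_mul, ← zpow_mul, mul_comm]
      have hN : (q ^ 2) ^ N = (q ^ N) ^ 2 := by rw [← pow_mul, ← pow_mul, mul_comm]
      have hqn : q ^ n ≠ 0 := zpow_ne_zero _ hq0
      rw [e1, e2, e3, e4]
      simp only [zpow_add₀ hp0, zpow_sub₀ hp0, zpow_one, zpow_natCast, hn, hN]
      simp only [pow_succ, pow_mul, pow_zero, one_mul]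
      field_simp
      ring
    · rw [qPochN_succ, qPochN_succ]
      have hN : (q ^ 2) ^ N = (q ^ N) ^ 2 := by rw [← pow_mul, ← pow_mul, mul_comm]
      rw [hN]
      field_simp
      ring

lemma summable_neg_mul_pow {p : ℂ} (hp : ‖p‖ < 1) (a : ℂ) :
    Summable fun j : ℕ => ‖-(a * p ^ j)‖ := by
  simpa using (summable_geometric_of_lt_one (norm_nonneg _) hp).mul_left ‖a‖

lemma multipliable_qPoch {p : ℂ} (hp : ‖p‖ < 1) (a : ℂ) :
    Multipliable fun j : ℕ => 1 - a * p ^ j := by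
  simpa [sub_eq_add_neg] using multipliable_one_add_of_summable (summable_neg_mul_pow hp a)

lemma tendsto_qPochN {p : ℂ} (hp : ‖p‖ < 1) (a : ℂ) :
    Tendsto (qPochN a p) atTop (nhds (qPochInf a p)) :=
  (multipliable_qPoch hp a).tendsto_prod_tprod_nat

lemma qPochInf_ne_zero {p : ℂ} (hp : ‖p‖ < 1) {a : ℂ} (h : ∀ j : ℕ, 1 - a * p ^ j ≠ 0) :
    qPochInf a p ≠ 0 := by
  have := tprod_one_add_ne_zero_of_summable (f := fun j : ℕ => -(a * p ^ j))
    (fun j => by simpa [sub_eq_add_neg] using h j) (summable_neg_mul_pow hp a)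
  simpa [qPochInf, sub_eq_add_neg] using this

lemma qPochInf_eq_zero {p : ℂ} {a : ℂ} {j : ℕ} (h : 1 - a * p ^ j = 0) : qPochInf a p = 0 :=
  tprod_of_exists_eq_zero ⟨j, h⟩

lemma qPochInf_self_ne_zero {p : ℂ} (hp : ‖p‖ < 1) : qPochInf p p ≠ 0 :=
  qPochInf_ne_zero hp (one_sub_pow_ne_zero hp)

lemma qPochInf_eq_mul {p : ℂ} (hp : ‖p‖ < 1) (a : ℂ) :
    qPochInf a p = (1 - a) * qPochInf (a * p) p := by
  have e (j : ℕ) : 1 - a * p ^ (j + 1) = 1 - a * p * p ^ j := by ring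
  have h : Multipliable fun j : ℕ => 1 - a * p ^ (j + 1) := by
    simpa only [e] using multipliable_qPoch hp (a * p)
  have h' := tprod_eq_zero_mul' (f := fun j : ℕ => 1 - a * p ^ j) h
  simpa only [pow_zero, mul_one, qPochInf, e] using h'

lemma qPochInf_even_mul_odd {p : ℂ} (hp : ‖p‖ < 1) (a : ℂ) :
    qPochInf a p = qPochInf a (p ^ 2) * qPochInf (a * p) (p ^ 2) := by
  have hp2 : ‖p ^ 2‖ < 1 := by
    rw [norm_pow]; exact pow_lt_one₀ (norm_nonneg _) hp two_ne_zero
  have e (j : ℕ) : 1 - a * p ^ (2 * j) = 1 - a * (p ^ 2) ^ j := by ring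
  have e' (j : ℕ) : 1 - a * p ^ (2 * j + 1) = 1 - a * p * (p ^ 2) ^ j := by ring
  rw [qPochInf, ← tprod_even_mul_odd]
  · simp only [e, e', qPochInf]
  · simpa only [e] using multipliable_qPoch hp2 a
  · simpa only [e'] using multipliable_qPoch hp2 (a * p)

lemma qPochInf_mul_neg {p : ℂ} (hp : ‖p‖ < 1) (a : ℂ) :
    qPochInf a p * qPochInf (-a) p = qPochInf (a ^ 2) (p ^ 2) := by
  rw [qPochInf, qPochInf, ← (multipliable_qPoch hp a).tprod_mul (multipliable_qPoch hp (-a))]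
  exact tprod_congr fun j => by ring

lemma continuous_qPochInf {p : ℂ} (hp : ‖p‖ < 1) : Continuous fun a => qPochInf a p := by
  rw [continuous_iff_continuousAt]
  intro a₀
  have hK : IsCompact (Metric.closedBall a₀ 1) := isCompact_closedBall a₀ 1
  have hu : Summable fun j : ℕ => (‖a₀‖ + 1) * ‖p‖ ^ j :=
    (summable_geometric_of_lt_one (norm_nonneg _) hp).mul_left _
  have := Summable.hasProdUniformlyOn_nat_one_add (R := ℂ) (f := fun j a => -(a * p ^ j)) hK hu
    (Eventually.of_forall fun n a ha => ?_) (fun n => by fun_prop)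
  · rw [hasProdUniformlyOn_iff_tendstoUniformlyOn] at this
    have hc := this.continuousOn (Frequently.of_forall fun s => by
      exact continuousOn_finsetProd _ fun i _ => by fun_prop)
    have := hc.continuousAt (Metric.closedBall_mem_nhds a₀ one_pos)
    simpa [qPochInf, sub_eq_add_neg] using this
  · rw [norm_neg, norm_mul, norm_pow]
    gcongr
    have : ‖a - a₀‖ ≤ 1 := by simpa [dist_eq_norm] using ha
    calc ‖a‖ = ‖a₀ + (a - a₀)‖ := by ring_nf
      _ ≤ ‖a₀‖ + ‖a - a₀‖ := norm_add_le _ _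
      _ ≤ _ := by gcongr

lemma norm_exp_pi_mul_I_lt_one {τ : ℂ} (hτ : 0 < τ.im) : ‖Complex.exp (π * I * τ)‖ < 1 := by
  rw [Complex.norm_exp]
  simp only [mul_re, ofReal_re, I_re, mul_zero, ofReal_im, I_im, mul_one, sub_self, zero_mul,
    mul_im, add_zero, zero_sub, Real.exp_lt_one_iff]
  nlinarith [mul_pos Real.pi_pos hτ]

lemma jacobiTheta₂_term_eq (n : ℤ) (z τ : ℂ) :
    jacobiTheta₂_term n z τ =
      Complex.exp (π * I * τ) ^ (n ^ 2) * Complex.exp (2 * π * I * z) ^ n := by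
  rw [jacobiTheta₂_term, ← Complex.exp_int_mul, ← Complex.exp_int_mul, ← Complex.exp_add]
  push_cast
  ring_nf

lemma exists_norm_qPochRecip_le {p : ℂ} (hp : ‖p‖ < 1) : ∃ C, ∀ m, ‖qPochRecip p m‖ ≤ C := by
  have h := (tendsto_qPochN hp p).inv₀ (qPochInf_self_ne_zero hp)
  obtain ⟨C, hC⟩ := (Metric.isBounded_range_of_tendsto _ h).exists_norm_le
  refine ⟨C, fun m => ?_⟩
  unfold qPochRecip
  split_ifs
  · simpa using (norm_nonneg _).trans (hC _ ⟨0, rfl⟩)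
  · exact hC _ ⟨_, rfl⟩

/-- The Jacobi triple product. -/
theorem jacobiTheta₂_eq_qPochInf (z : ℂ) {τ : ℂ} (hτ : 0 < τ.im) :
    jacobiTheta₂ z τ = qPochInf (Complex.exp (π * I * τ) ^ 2) (Complex.exp (π * I * τ) ^ 2) *
      (qPochInf (-(Complex.exp (2 * π * I * z) * Complex.exp (π * I * τ)))
          (Complex.exp (π * I * τ) ^ 2) *
        qPochInf (-((Complex.exp (2 * π * I * z))⁻¹ * Complex.exp (π * I * τ)))
          (Complex.exp (π * I * τ) ^ 2)) := by
  have hq := norm_exp_pi_mul_I_lt_one hτ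
  have hq0 := Complex.exp_ne_zero (π * I * τ)
  have hx := Complex.exp_ne_zero (2 * π * I * z)
  have hs : Summable fun n => jacobiTheta₂_term n z τ := (summable_jacobiTheta₂_term_iff z τ).2 hτ
  simp only [jacobiTheta₂, jacobiTheta₂_term_eq] at hs ⊢
  set q := Complex.exp (π * I * τ)
  set x := Complex.exp (2 * π * I * z)
  have hp : ‖q ^ 2‖ < 1 := by
    rw [norm_pow]; exact pow_lt_one₀ (norm_nonneg _) hq two_ne_zero
  have hP := qPochInf_self_ne_zero hp
  have hP' := tendsto_qPochN hp (q ^ 2)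
  have hrec (m : ℤ → ℕ → ℤ) (hm : ∀ n, Tendsto (m n) atTop atTop) (n : ℤ) :
      Tendsto (fun N => qPochRecip (q ^ 2) (m n N)) atTop (nhds (qPochInf (q ^ 2) (q ^ 2))⁻¹) := by
    have h1 : Tendsto (fun N => (m n N).toNat) atTop atTop :=
      tendsto_atTop.2 fun b => ((hm n).eventually_ge_atTop (b : ℤ)).mono fun N hN => by omega
    refine ((hP'.comp h1).inv₀ hP).congr' ?_
    filter_upwards [(hm n).eventually_ge_atTop 0] with N hN
    simp [qPochRecip, not_lt.2 hN]
  obtain ⟨C, hC⟩ := exists_norm_qPochRecip_le hp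
  obtain ⟨D, hD⟩ := (Metric.isBounded_range_of_tendsto _ hP').exists_norm_le
  have hC0 : 0 ≤ C := (norm_nonneg _).trans (hC 0)
  have hD0 : 0 ≤ D := (norm_nonneg _).trans (hD _ ⟨0, rfl⟩)
  have key := tendsto_tsum_of_dominated_convergence (𝓕 := (atTop : Filter ℕ))
    (f := fun N (n : ℤ) => qPochN (q ^ 2) (q ^ 2) (2 * N) * qPochRecip (q ^ 2) (N + n) *
        qPochRecip (q ^ 2) (N - n) * (q ^ (n ^ 2) * x ^ n))
    (g := fun n : ℤ => qPochInf (q ^ 2) (q ^ 2) * (qPochInf (q ^ 2) (q ^ 2))⁻¹ *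
        (qPochInf (q ^ 2) (q ^ 2))⁻¹ * (q ^ (n ^ 2) * x ^ n))
    (bound := fun n => D * C * C * ‖q ^ (n ^ 2) * x ^ n‖) (hs.norm.mul_left _)
    (fun n => by
      refine (((hP'.comp (tendsto_id.const_mul_atTop' two_pos)).mul
        (hrec (fun n N => N + n) (fun n => ?_) n)).mul
        (hrec (fun n N => N - n) (fun n => ?_) n)).mul_const _
      · exact tendsto_atTop_add_const_right _ _ tendsto_natCast_atTop_atTop
      · exact tendsto_atTop_add_const_right _ _ tendsto_natCast_atTop_atTop)
    (Eventually.of_forall fun N n => by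
      rw [norm_mul, norm_mul, norm_mul]
      gcongr
      · exact hD _ ⟨_, rfl⟩
      · exact hC _
      · exact hC _)
  simp only [(hasSum_qBinomial_theta hq hq0 hx _).tsum_eq, tsum_mul_left] at key
  have h2 := tendsto_nhds_unique key ((tendsto_qPochN hp _).mul (tendsto_qPochN hp _))
  rw [← h2]
  field_simp

/-- The function `1 / (1 - z q ^ (2 n))`, where `z = exp (2 π i u)` and `q = exp (2 π i t)`. -/
def poleTerm (n : ℤ) (u t : ℂ) : ℂ := (1 - Complex.exp (2 * π * I * (u + 2 * n * t)))⁻¹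

lemma norm_exp_shift (n : ℤ) (u t : ℂ) :
    ‖Complex.exp (2 * π * I * (u + 2 * n * t))‖ = Real.exp (-(2 * π * (u.im + 2 * n * t.im))) := by
  rw [Complex.norm_exp]
  congr 1
  have : (2 * π * I * (u + 2 * n * t) : ℂ) =
      ((2 * π : ℝ) : ℂ) * (I * (u + ((2 * n : ℝ) : ℂ) * t)) := by push_cast; ring
  rw [this, re_ofReal_mul, I_mul_re, add_im, im_ofReal_mul]
  ring

lemma exp_neg_two_pi_le : Real.exp (-(2 * π)) ≤ 1 / 2 := by
  have h1 : (2 : ℝ) ≤ Real.exp (2 * π) := by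
    have := Real.add_one_le_exp (2 * π)
    linarith [Real.pi_gt_three]
  rw [Real.exp_neg, one_div]
  exact inv_anti₀ two_pos h1

lemma half_le_norm_one_sub_exp {u t : ℂ} {n : ℤ} (h : 1 ≤ |u.im + 2 * n * t.im|) :
    1 / 2 ≤ ‖1 - Complex.exp (2 * π * I * (u + 2 * n * t))‖ := by
  have hn := norm_exp_shift n u t
  rcases le_abs.1 h with h | h
  · have h1 : ‖Complex.exp (2 * π * I * (u + 2 * n * t))‖ ≤ 1 / 2 := by
      rw [hn]
      refine (Real.exp_le_exp.2 ?_).trans exp_neg_two_pi_le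
      nlinarith [Real.pi_pos]
    have h2 := norm_sub_norm_le (1 : ℂ) (Complex.exp (2 * π * I * (u + 2 * n * t)))
    rw [norm_one] at h2
    linarith
  · have h1 : 2 ≤ ‖Complex.exp (2 * π * I * (u + 2 * n * t))‖ := by
      rw [hn]
      have := Real.add_one_le_exp (-(2 * π * (u.im + 2 * n * t.im)))
      nlinarith [Real.pi_gt_three]
    have h2 := norm_sub_norm_le (Complex.exp (2 * π * I * (u + 2 * n * t))) (1 : ℂ)
    rw [norm_one, norm_sub_rev] at h2
    linarith

lemma exists_norm_poleTerm_le {u₀ t₀ : ℂ} (ht : 0 < t₀.im) (s : Set ℤ)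
    (h : ∀ n ∈ s, 1 - Complex.exp (2 * π * I * (u₀ + 2 * n * t₀)) ≠ 0) :
    ∃ C : ℝ, ∀ᶠ p in nhds (u₀, t₀), ∀ n ∈ s,
      1 - Complex.exp (2 * π * I * (p.1 + 2 * n * p.2)) ≠ 0 ∧ ‖poleTerm n p.1 p.2‖ ≤ C := by
  obtain ⟨N, hN⟩ := exists_nat_gt ((|u₀.im| + 2) / t₀.im)
  rw [div_lt_iff₀ ht] at hN
  have hfar : ∀ᶠ p : ℂ × ℂ in nhds (u₀, t₀), ∀ n : ℤ, (N : ℤ) ≤ |n| →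
      1 ≤ |p.1.im + 2 * n * p.2.im| := by
    have h1 : ∀ᶠ p : ℂ × ℂ in nhds (u₀, t₀), |p.1.im| < |u₀.im| + 1 := by
      have : ContinuousAt (fun p : ℂ × ℂ => |p.1.im|) (u₀, t₀) := by fun_prop
      exact this.eventually_lt_const (by simp)
    have h2 : ∀ᶠ p : ℂ × ℂ in nhds (u₀, t₀), t₀.im / 2 < p.2.im := by
      have : ContinuousAt (fun p : ℂ × ℂ => p.2.im) (u₀, t₀) := by fun_prop
      exact this.eventually_const_lt (by simp [ht])
    filter_upwards [h1, h2] with p hp1 hp2 n hn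
    have hn' : (N : ℝ) ≤ |(n : ℝ)| := by exact_mod_cast hn
    have e1 : |2 * (n : ℝ) * p.2.im| = 2 * |(n : ℝ)| * p.2.im := by
      rw [abs_mul, abs_mul, abs_of_pos (show (0 : ℝ) < p.2.im by linarith), abs_two]
    have e2 := abs_sub_abs_le_abs_sub (2 * (n : ℝ) * p.2.im) (-p.1.im)
    rw [abs_neg, e1, sub_neg_eq_add, add_comm (2 * (n : ℝ) * p.2.im)] at e2
    have e3 : (N : ℝ) * (t₀.im / 2) ≤ |(n : ℝ)| * p.2.im :=
      mul_le_mul hn' hp2.le (by linarith) (abs_nonneg _)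
    linarith
  have hnear : ∀ᶠ p : ℂ × ℂ in nhds (u₀, t₀), ∀ n ∈ Finset.Icc (-(N : ℤ)) N, n ∈ s →
      1 - Complex.exp (2 * π * I * (p.1 + 2 * n * p.2)) ≠ 0 ∧
        ‖poleTerm n p.1 p.2‖ < ‖poleTerm n u₀ t₀‖ + 1 := by
    rw [Filter.eventually_all_finset]
    intro n _
    by_cases hns : n ∈ s
    · have c1 : ContinuousAt
          (fun p : ℂ × ℂ => 1 - Complex.exp (2 * π * I * (p.1 + 2 * n * p.2))) (u₀, t₀) := by
        fun_prop
      have c2 : ContinuousAt (fun p : ℂ × ℂ => ‖poleTerm n p.1 p.2‖) (u₀, t₀) :=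
        (c1.inv₀ (h n hns)).norm
      filter_upwards [c1.eventually_ne (h n hns), c2.eventually_lt_const (lt_add_one _)]
        with p hp1 hp2 _ using ⟨hp1, hp2⟩
    · exact Eventually.of_forall fun p hn => absurd hn hns
  refine ⟨2 + ∑ n ∈ Finset.Icc (-(N : ℤ)) N, (‖poleTerm n u₀ t₀‖ + 1), ?_⟩
  filter_upwards [hfar, hnear] with p hp1 hp2 n hns
  have hsum : 0 ≤ ∑ n ∈ Finset.Icc (-(N : ℤ)) N, (‖poleTerm n u₀ t₀‖ + 1) :=
    Finset.sum_nonneg fun _ _ => by positivity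
  by_cases hn : (N : ℤ) ≤ |n|
  · have h1 := half_le_norm_one_sub_exp (hp1 n hn)
    refine ⟨norm_pos_iff.1 (by linarith), ?_⟩
    rw [poleTerm, norm_inv]
    have := inv_anti₀ (by norm_num) h1
    norm_num at this
    linarith
  · have hmem : n ∈ Finset.Icc (-(N : ℤ)) N := by
      rw [Finset.mem_Icc]
      exact abs_le.1 (not_le.1 hn).le
    obtain ⟨h1, h2⟩ := hp2 n hmem hns
    refine ⟨h1, ?_⟩
    have := Finset.single_le_sum (f := fun n => ‖poleTerm n u₀ t₀‖ + 1)
      (fun _ _ => by positivity) hmem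
    linarith

/-- The summand of `appellSum`. -/
def appellTerm (k j : ℕ) (n : ℤ) (u t : ℂ) : ℂ :=
  (-1) ^ n * (2 * n + 3 / 2) ^ k * Complex.exp (π * I * (2 * n + 3 / 2) ^ 2 * t) *
    poleTerm n u t ^ j

/-- The sums `Σ (-1)^n (2n + 3/2)^k q^((2n + 3/2)^2 / 2) / (1 - z q^(2n))^j`. -/
def appellSum (k j : ℕ) (u t : ℂ) : ℂ := ∑' n : ℤ, appellTerm k j n u t

lemma summable_pow_mul_exp_neg_sq (k : ℕ) {c : ℝ} (hc : 0 < c) :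
    Summable fun n : ℤ => |2 * (n : ℝ) + 3 / 2| ^ k * Real.exp (-π * (c * (2 * n + 3 / 2) ^ 2)) := by
  have h1 := (summable_pow_mul_jacobiTheta₂_term_bound (3 * c) (T := 4 * c) (by positivity) k).add
    (summable_pow_mul_jacobiTheta₂_term_bound (3 * c) (T := 4 * c) (by positivity) 0)
  refine Summable.of_nonneg_of_le (fun n => by positivity) (fun n => ?_) (h1.mul_left (4 ^ k))
  have h2 : |2 * (n : ℝ) + 3 / 2| ≤ 2 * (|(n : ℝ)| + 1) := by
    rw [abs_le]
    constructor <;> cases abs_cases (n : ℝ) <;> linarith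
  have h3 : |2 * (n : ℝ) + 3 / 2| ^ k ≤ 4 ^ k * (|(n : ℝ)| ^ k + 1) :=
    calc |2 * (n : ℝ) + 3 / 2| ^ k ≤ (2 * (|(n : ℝ)| + 1)) ^ k := by gcongr
      _ = 2 ^ k * (|(n : ℝ)| + 1) ^ k := mul_pow _ _ _
      _ ≤ 2 ^ k * (2 ^ k * (|(n : ℝ)| ^ k + 1 ^ k)) := by
        gcongr
        refine (add_pow_le (abs_nonneg _) zero_le_one k).trans ?_
        gcongr
        · norm_num
        · omega
      _ = (2 * 2) ^ k * (|(n : ℝ)| ^ k + 1) := by rw [mul_pow, one_pow]; ring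
      _ = _ := by norm_num
  have h4 : Real.exp (-π * (c * (2 * n + 3 / 2) ^ 2)) ≤
      Real.exp (-π * (4 * c * n ^ 2 - 2 * (3 * c) * |(n : ℝ)|)) := by
    apply Real.exp_le_exp.2
    have : 4 * c * (n : ℝ) ^ 2 - 2 * (3 * c) * |(n : ℝ)| ≤ c * (2 * n + 3 / 2) ^ 2 := by
      nlinarith [neg_abs_le (n : ℝ)]
    nlinarith [Real.pi_pos]
  calc _ ≤ (4 ^ k * (|(n : ℝ)| ^ k + 1)) *
        Real.exp (-π * (4 * c * n ^ 2 - 2 * (3 * c) * |(n : ℝ)|)) :=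
      mul_le_mul h3 h4 (Real.exp_pos _).le (by positivity)
    _ = _ := by push_cast; ring

lemma exists_norm_appellTerm_le (k j : ℕ) {u₀ t₀ : ℂ} (ht : 0 < t₀.im) (s : Set ℤ)
    (h : ∀ n ∈ s, 1 - Complex.exp (2 * π * I * (u₀ + 2 * n * t₀)) ≠ 0) :
    ∃ b : ℤ → ℝ, Summable b ∧ ∀ᶠ p in nhds (u₀, t₀), ∀ n ∈ s,
      1 - Complex.exp (2 * π * I * (p.1 + 2 * n * p.2)) ≠ 0 ∧
        ‖appellTerm k j n p.1 p.2‖ ≤ b n := by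
  obtain ⟨C, hC⟩ := exists_norm_poleTerm_le ht s h
  refine ⟨_, (summable_pow_mul_exp_neg_sq k (half_pos ht)).mul_right (C ^ j), ?_⟩
  have h2 : ∀ᶠ p : ℂ × ℂ in nhds (u₀, t₀), t₀.im / 2 < p.2.im := by
    have : ContinuousAt (fun p : ℂ × ℂ => p.2.im) (u₀, t₀) := by fun_prop
    exact this.eventually_const_lt (by simp [ht])
  filter_upwards [hC, h2] with p hp1 hp2 n hn
  obtain ⟨h3, h4⟩ := hp1 n hn
  refine ⟨h3, ?_⟩
  have hm : (2 * n + 3 / 2 : ℂ) = ((2 * n + 3 / 2 : ℝ) : ℂ) := by push_cast; ring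
  rw [appellTerm, norm_mul, norm_mul, norm_mul, norm_zpow, norm_neg, norm_one, one_zpow, one_mul,
    norm_pow, norm_pow, hm, Complex.norm_real, Real.norm_eq_abs]
  gcongr
  rw [Complex.norm_exp]
  apply Real.exp_le_exp.2
  have : (π * I * ((2 * n + 3 / 2 : ℝ) : ℂ) ^ 2 * p.2 : ℂ) =
      ((π * (2 * n + 3 / 2) ^ 2 : ℝ) : ℂ) * (I * p.2) := by push_cast; ring
  rw [this, re_ofReal_mul, I_mul_re]
  nlinarith [mul_nonneg Real.pi_pos.le (sq_nonneg (2 * (n : ℝ) + 3 / 2))]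

lemma hasDerivAt_tsum_of_eventually_le {f : ℤ → ℂ → ℂ} {f' : ℤ → ℂ} {b : ℤ → ℝ} {z : ℂ}
    (hb : Summable b)
    (h : ∀ᶠ w in nhds z, ∀ n, DifferentiableAt ℂ (f n) w ∧ ‖f n w‖ ≤ b n)
    (hf' : ∀ n, HasDerivAt (f n) (f' n) z) :
    HasDerivAt (fun w => ∑' n, f n w) (∑' n, f' n) z := by
  obtain ⟨U, hU, hUo, hz⟩ := eventually_nhds_iff.1 h
  have hd (n : ℤ) : DifferentiableOn ℂ (f n) U := fun w hw => (hU w hw n).1.differentiableWithinAt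
  have hle (n : ℤ) (w : ℂ) (hw : w ∈ U) : ‖f n w‖ ≤ b n := (hU w hw n).2
  have h1 := (differentiableOn_tsum_of_summable_norm hb hd hUo hle).differentiableAt
    (hUo.mem_nhds hz)
  have h2 := (hasSum_deriv_of_summable_norm hb hd hUo hle hz).tsum_eq
  rw [tsum_congr fun n => (hf' n).deriv] at h2
  rw [h2]
  exact h1.hasDerivAt

lemma hasDerivAt_poleTerm_fst {n : ℤ} {u t : ℂ}
    (h : 1 - Complex.exp (2 * π * I * (u + 2 * n * t)) ≠ 0) :
    HasDerivAt (fun w => poleTerm n w t)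
      (2 * π * I * (poleTerm n u t ^ 2 - poleTerm n u t)) u := by
  have h1 : HasDerivAt (fun w => 2 * π * I * (w + 2 * n * t)) (2 * π * I) u := by
    simpa using ((hasDerivAt_id u).add_const (2 * n * t)).const_mul (2 * π * I)
  refine (((h1.cexp).const_sub 1).inv h).congr_deriv ?_
  rw [poleTerm]
  field_simp
  ring

lemma hasDerivAt_poleTerm_snd {n : ℤ} {u t : ℂ}
    (h : 1 - Complex.exp (2 * π * I * (u + 2 * n * t)) ≠ 0) :
    HasDerivAt (fun w => poleTerm n u w)
      (4 * π * I * n * (poleTerm n u t ^ 2 - poleTerm n u t)) t := by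
  have h1 : HasDerivAt (fun w => 2 * π * I * (u + 2 * n * w)) (4 * π * I * n) t := by
    refine ((((hasDerivAt_id t).const_mul (2 * n : ℂ)).const_add u).const_mul
      (2 * π * I)).congr_deriv ?_
    ring
  refine (((h1.cexp).const_sub 1).inv h).congr_deriv ?_
  rw [poleTerm]
  field_simp
  ring

lemma natCast_mul_pow_pred_mul (j : ℕ) (r : ℂ) :
    (j : ℂ) * r ^ (j - 1) * (r ^ 2 - r) = j * (r ^ (j + 1) - r ^ j) := by
  cases j with
  | zero => simp
  | succ j => rw [Nat.add_sub_cancel]; ring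

lemma hasDerivAt_appellTerm_fst (k j : ℕ) {n : ℤ} {u t : ℂ}
    (h : 1 - Complex.exp (2 * π * I * (u + 2 * n * t)) ≠ 0) :
    HasDerivAt (fun w => appellTerm k j n w t)
      (2 * π * I * j * (appellTerm k (j + 1) n u t - appellTerm k j n u t)) u := by
  refine (((hasDerivAt_poleTerm_fst h).pow j).const_mul _).congr_deriv ?_
  simp only [appellTerm]
  linear_combination ((-1) ^ n * (2 * n + 3 / 2) ^ k *
    Complex.exp (π * I * (2 * n + 3 / 2) ^ 2 * t)) * (2 * π * I) *
    natCast_mul_pow_pred_mul j (poleTerm n u t)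

lemma hasDerivAt_appellTerm_snd (k j : ℕ) {n : ℤ} {u t : ℂ}
    (h : 1 - Complex.exp (2 * π * I * (u + 2 * n * t)) ≠ 0) :
    HasDerivAt (fun w => appellTerm k j n u w)
      (π * I * appellTerm (k + 2) j n u t +
        2 * π * I * j * (appellTerm (k + 1) (j + 1) n u t - appellTerm (k + 1) j n u t) -
        3 * π * I * j * (appellTerm k (j + 1) n u t - appellTerm k j n u t)) t := by
  have h1 : HasDerivAt (fun w => π * I * (2 * n + 3 / 2) ^ 2 * w)
      (π * I * (2 * n + 3 / 2) ^ 2) t := by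
    simpa using (hasDerivAt_id t).const_mul (π * I * (2 * n + 3 / 2 : ℂ) ^ 2)
  refine ((h1.cexp.const_mul _).mul ((hasDerivAt_poleTerm_snd h).pow j)).congr_deriv ?_
  simp only [appellTerm, Pi.pow_apply]
  linear_combination ((-1) ^ n * (2 * n + 3 / 2) ^ k *
    Complex.exp (π * I * (2 * n + 3 / 2) ^ 2 * t)) * (4 * π * I * n) *
    natCast_mul_pow_pred_mul j (poleTerm n u t)

lemma summable_appellTerm (k j : ℕ) {u t : ℂ} (ht : 0 < t.im)
    (h : ∀ n : ℤ, 1 - Complex.exp (2 * π * I * (u + 2 * n * t)) ≠ 0) :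
    Summable fun n => appellTerm k j n u t := by
  obtain ⟨b, hb, hle⟩ := exists_norm_appellTerm_le k j ht Set.univ fun n _ => h n
  exact Summable.of_norm_bounded hb fun n => (hle.self_of_nhds n (Set.mem_univ n)).2

lemma hasDerivAt_appellSum_fst (k j : ℕ) {u t : ℂ} (ht : 0 < t.im)
    (h : ∀ n : ℤ, 1 - Complex.exp (2 * π * I * (u + 2 * n * t)) ≠ 0) :
    HasDerivAt (fun w => appellSum k j w t)
      (2 * π * I * j * (appellSum k (j + 1) u t - appellSum k j u t)) u := by
  obtain ⟨b, hb, hle⟩ := exists_norm_appellTerm_le k j ht Set.univ fun n _ => h n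
  have hc : Tendsto (fun w : ℂ => (w, t)) (nhds u) (nhds (u, t)) :=
    Continuous.tendsto (by fun_prop) u
  refine (hasDerivAt_tsum_of_eventually_le hb ?_ fun n =>
    hasDerivAt_appellTerm_fst k j (h n)).congr_deriv ?_
  · filter_upwards [hc.eventually hle] with w hw n
    obtain ⟨h1, h2⟩ := hw n (Set.mem_univ n)
    exact ⟨(hasDerivAt_appellTerm_fst k j h1).differentiableAt, h2⟩
  · exact (((summable_appellTerm k (j + 1) ht h).hasSum.sub
      (summable_appellTerm k j ht h).hasSum).mul_left _).tsum_eq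

lemma hasDerivAt_appellSum_snd (k j : ℕ) {u t : ℂ} (ht : 0 < t.im)
    (h : ∀ n : ℤ, 1 - Complex.exp (2 * π * I * (u + 2 * n * t)) ≠ 0) :
    HasDerivAt (fun w => appellSum k j u w)
      (π * I * appellSum (k + 2) j u t +
        2 * π * I * j * (appellSum (k + 1) (j + 1) u t - appellSum (k + 1) j u t) -
        3 * π * I * j * (appellSum k (j + 1) u t - appellSum k j u t)) t := by
  obtain ⟨b, hb, hle⟩ := exists_norm_appellTerm_le k j ht Set.univ fun n _ => h n
  have hc : Tendsto (fun w : ℂ => (u, w)) (nhds t) (nhds (u, t)) :=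
    Continuous.tendsto (by fun_prop) t
  refine (hasDerivAt_tsum_of_eventually_le hb ?_ fun n =>
    hasDerivAt_appellTerm_snd k j (h n)).congr_deriv ?_
  · filter_upwards [hc.eventually hle] with w hw n
    obtain ⟨h1, h2⟩ := hw n (Set.mem_univ n)
    exact ⟨(hasDerivAt_appellTerm_snd k j h1).differentiableAt, h2⟩
  · exact ((((summable_appellTerm (k + 2) j ht h).hasSum.mul_left _).add
      (((summable_appellTerm (k + 1) (j + 1) ht h).hasSum.sub
        (summable_appellTerm (k + 1) j ht h).hasSum).mul_left _)).sub
      (((summable_appellTerm k (j + 1) ht h).hasSum.sub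
        (summable_appellTerm k j ht h).hasSum).mul_left _)).tsum_eq

lemma appellTerm_zero_right (k : ℕ) (n : ℤ) (u v t : ℂ) :
    appellTerm k 0 n u t = appellTerm k 0 n v t := by
  simp only [appellTerm, pow_zero]

lemma appellSum_zero_right (k : ℕ) (u v t : ℂ) : appellSum k 0 u t = appellSum k 0 v t :=
  tsum_congr fun n => appellTerm_zero_right k n u v t

lemma one_sub_exp_self_ne_zero {t : ℂ} (ht : 0 < t.im) (n : ℤ) :
    1 - Complex.exp (2 * π * I * (t + 2 * n * t)) ≠ 0 := by
  intro h
  obtain ⟨m, hm⟩ := Complex.exp_eq_one_iff.1 (sub_eq_zero.1 h).symm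
  have h1 : t + 2 * n * t = m := by
    have : (2 * π * I : ℂ) ≠ 0 := Complex.two_pi_I_ne_zero
    apply mul_left_cancel₀ this
    rw [hm]; ring
  have h2 := congrArg Complex.im h1
  have h3 : t + 2 * n * t = ((1 + 2 * n : ℝ) : ℂ) * t := by push_cast; ring
  rw [h3, Complex.im_ofReal_mul, Complex.intCast_im] at h2
  rcases mul_eq_zero.1 h2 with h4 | h4
  · have : (1 + 2 * n : ℤ) = 0 := by exact_mod_cast h4
    omega
  · exact ht.ne' h4

lemma hasDerivAt_appellSum_zero_right (k : ℕ) {u t : ℂ} (ht : 0 < t.im) :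
    HasDerivAt (fun w => appellSum k 0 u w) (π * I * appellSum (k + 2) 0 u t) t := by
  have h := hasDerivAt_appellSum_snd k 0 ht (one_sub_exp_self_ne_zero ht)
  simp only [Nat.cast_zero, mul_zero, zero_mul, add_zero, sub_zero] at h
  simpa only [appellSum_zero_right _ t u] using h

lemma exp_mul_I_add_half (n : ℤ) :
    Complex.exp (π * I * ((n : ℂ) + 1 / 2)) = I * (-1) ^ n := by
  rw [mul_add, Complex.exp_add, show (π : ℂ) * I * (1 / 2) = π / 2 * I by ring,
    Complex.exp_pi_div_two_mul_I, mul_comm (π * I : ℂ) n, Complex.exp_int_mul,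
    Complex.exp_pi_mul_I, mul_comm]

lemma jTheta_eq_jacobiTheta₂ (v t : ℂ) :
    jTheta v t = I * Complex.exp (π * I * t / 4) *
      (Complex.exp (π * I * v) * jacobiTheta₂ (v + 1 / 2 + t / 2) t) := by
  have h0 : I * Complex.exp (π * I * t / 4) * Complex.exp (π * I * v) =
      Complex.exp (π / 2 * I + π * I * t / 4 + π * I * v) := by
    rw [Complex.exp_add, Complex.exp_add, Complex.exp_pi_div_two_mul_I]
  rw [jTheta, jacobiTheta₂, ← mul_assoc, h0, ← tsum_mul_left]
  refine tsum_congr fun n => ?_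
  rw [jacobiTheta₂_term, ← Complex.exp_add]
  congr 1
  ring

lemma jTheta_self (u t : ℂ) :
    jTheta t (4 * t) = I * Complex.exp (-(π * I * t / 4)) * appellSum 0 0 u t := by
  rw [jTheta, appellSum, ← tsum_mul_left]
  refine tsum_congr fun n => ?_
  rw [appellTerm, pow_zero, pow_zero, mul_one, mul_one]
  rw [show (π * I * ((n : ℂ) + 1 / 2) ^ 2 * (4 * t) + 2 * π * I * ((n : ℂ) + 1 / 2) * (t + 1 / 2) : ℂ)
    = π * I * ((n : ℂ) + 1 / 2) + (-(π * I * t / 4) + π * I * (2 * n + 3 / 2) ^ 2 * t) by ring,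
    Complex.exp_add, Complex.exp_add, exp_mul_I_add_half]
  ring

lemma jTheta_three_mul (u t : ℂ) :
    jTheta (3 * t) (4 * t) = I * Complex.exp (-(9 * π * I * t / 4)) * appellSum 0 0 u t := by
  rw [jTheta, appellSum, ← tsum_mul_left,
    ← ((Equiv.neg ℤ).trans (Equiv.subRight 2)).tsum_eq]
  refine tsum_congr fun n => ?_
  rw [appellTerm, pow_zero, pow_zero, mul_one, mul_one]
  simp only [Equiv.trans_apply, Equiv.neg_apply, Equiv.subRight_apply]
  rw [show (π * I * (((-n - 2 : ℤ) : ℂ) + 1 / 2) ^ 2 * (4 * t) +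
      2 * π * I * (((-n - 2 : ℤ) : ℂ) + 1 / 2) * (3 * t + 1 / 2) : ℂ)
    = π * I * (((-n - 2 : ℤ) : ℂ) + 1 / 2) +
      (-(9 * π * I * t / 4) + π * I * (2 * n + 3 / 2) ^ 2 * t) by push_cast; ring,
    Complex.exp_add, Complex.exp_add, exp_mul_I_add_half]
  have : (-1 : ℂ) ^ (-n - 2) = (-1) ^ n := by
    rw [zpow_sub₀ (by norm_num), zpow_neg]
    rcases Int.even_or_odd n with h | h <;> simp [h.neg_one_zpow]
  rw [this]
  ring

lemma appellSum_zero_zero (u : ℂ) {t : ℂ} (ht : 0 < t.im) :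
    appellSum 0 0 u t = -(Complex.exp (π * I * t / 4) *
      (qPochInf (Complex.exp (2 * π * I * t) ^ 4) (Complex.exp (2 * π * I * t) ^ 4) *
        qPochInf (Complex.exp (2 * π * I * t)) (Complex.exp (2 * π * I * t) ^ 2))) := by
  have h4 : 0 < (4 * t).im := by
    have : (4 * t).im = 4 * t.im := by simp
    rw [this]; positivity
  have h2 : 0 < (2 * t).im := by
    have : (2 * t).im = 2 * t.im := by simp
    rw [this]; positivity
  set q := Complex.exp (2 * π * I * t) with hq
  have hqn : ‖q‖ < 1 := by
    have := norm_exp_pi_mul_I_lt_one h2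
    rwa [show (π : ℂ) * I * (2 * t) = 2 * π * I * t by ring] at this
  have hq4 : ‖q ^ 4‖ < 1 := by
    rw [norm_pow]; exact pow_lt_one₀ (norm_nonneg _) hqn (by norm_num)
  have hq2 : ‖q ^ 2‖ < 1 := by
    rw [norm_pow]; exact pow_lt_one₀ (norm_nonneg _) hqn (by norm_num)
  have hq0 : q ≠ 0 := Complex.exp_ne_zero _
  have h1 := jTheta_self u t
  rw [jTheta_eq_jacobiTheta₂, jacobiTheta₂_eq_qPochInf _ h4] at h1
  have e1 : Complex.exp (π * I * (4 * t)) = q ^ 2 := by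
    rw [hq, ← Complex.exp_nat_mul]; congr 1; push_cast; ring
  have e2 : Complex.exp (2 * π * I * (t + 1 / 2 + 4 * t / 2)) = -q ^ 3 := by
    rw [show (2 * π * I * (t + 1 / 2 + 4 * t / 2) : ℂ) = π * I + (3 : ℕ) * (2 * π * I * t) by
      push_cast; ring, Complex.exp_add, Complex.exp_pi_mul_I, Complex.exp_nat_mul, ← hq]
    ring
  have e3 : Complex.exp (π * I * (4 * t) / 4) * Complex.exp (π * I * t) = q := by
    rw [← Complex.exp_add, hq]; congr 1; ring
  rw [e1, e2] at h1
  rw [show (q ^ 2) ^ 2 = q ^ 4 by ring, show -(-q ^ 3 * q ^ 2) = q * q ^ 4 by ring,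
    show -((-q ^ 3)⁻¹ * q ^ 2) = q⁻¹ by field_simp] at h1
  have p1 := qPochInf_eq_mul hq4 q
  have p2 := qPochInf_eq_mul hq4 q⁻¹
  have p3 := qPochInf_even_mul_odd hq2 q
  rw [show q⁻¹ * q ^ 4 = q ^ 3 by field_simp] at p2
  rw [show (q ^ 2) ^ 2 = q ^ 4 by ring, show q * q ^ 2 = q ^ 3 by ring] at p3
  rw [p2] at h1
  rw [p3, p1]
  have e5 : Complex.exp (-(π * I * t / 4)) * Complex.exp (π * I * t / 4) = 1 := by
    rw [← Complex.exp_add]; simp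
  have e6 : q * q⁻¹ = 1 := mul_inv_cancel₀ hq0
  apply mul_left_cancel₀ (mul_ne_zero Complex.I_ne_zero (Complex.exp_ne_zero (-(π * I * t / 4))))
  rw [← h1]
  linear_combination (I * qPochInf (q ^ 4) (q ^ 4) * qPochInf (q * q ^ 4) (q ^ 4) * (1 - q⁻¹) *
    qPochInf (q ^ 3) (q ^ 4)) * e3 + (I * qPochInf (q ^ 4) (q ^ 4) * (1 - q) * qPochInf (q * q ^ 4) (q ^ 4) *
    qPochInf (q ^ 3) (q ^ 4)) * e5 - (I * qPochInf (q ^ 4) (q ^ 4) * qPochInf (q * q ^ 4) (q ^ 4) *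
    qPochInf (q ^ 3) (q ^ 4)) * e6

lemma appellSum_zero_zero_ne_zero (u : ℂ) {t : ℂ} (ht : 0 < t.im) : appellSum 0 0 u t ≠ 0 := by
  have h2 : 0 < (2 * t).im := by
    have : (2 * t).im = 2 * t.im := by simp
    rw [this]; positivity
  have hq := norm_exp_pi_mul_I_lt_one h2
  rw [show (π : ℂ) * I * (2 * t) = 2 * π * I * t by ring] at hq
  rw [appellSum_zero_zero u ht]
  set q := Complex.exp (2 * π * I * t)
  have hq4 : ‖q ^ 4‖ < 1 := by
    rw [norm_pow]; exact pow_lt_one₀ (norm_nonneg _) hq (by norm_num)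
  have hq2 : ‖q ^ 2‖ < 1 := by
    rw [norm_pow]; exact pow_lt_one₀ (norm_nonneg _) hq (by norm_num)
  refine neg_ne_zero.2 (mul_ne_zero (Complex.exp_ne_zero _) (mul_ne_zero
    (qPochInf_self_ne_zero hq4) (qPochInf_ne_zero hq2 fun j => ?_)))
  rw [← pow_mul]
  exact one_sub_pow_ne_zero hq (2 * j)

/-- The bracketed combination of Lerch sums in the heat equation. -/
def lerchBracket (u t : ℂ) : ℂ :=
  Complex.exp (π * I * u) * Complex.exp (-π * I * t / 4) * lerchMu (2 * u) t (4 * t)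
    + Complex.exp (-9 * π * I * t / 4) * Complex.exp (3 * π * I * u) *
      lerchMu (2 * u) (3 * t) (4 * t)

lemma lerchBracket_eq {u t : ℂ} (ht : 0 < t.im)
    (h : ∀ n : ℤ, 1 - Complex.exp (2 * π * I * (2 * u + 2 * n * (2 * t))) ≠ 0) :
    lerchBracket u t = Complex.exp (3 * π * I * u - 9 * π * I * t / 4) *
      appellSum 0 1 u t / (I * appellSum 0 0 u t) := by
  have hy (n : ℤ) : Complex.exp (2 * π * I * (2 * u + 2 * n * (2 * t))) =
      Complex.exp (2 * π * I * (u + 2 * n * t)) ^ 2 := by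
    rw [← Complex.exp_nat_mul]; congr 1; push_cast; ring
  have hs1 (n : ℤ) : 1 - Complex.exp (2 * π * I * (u + 2 * n * t)) ≠ 0 := by
    have := h n
    rw [hy] at this
    contrapose! this
    linear_combination (1 + Complex.exp (2 * π * I * (u + 2 * n * t))) * this
  have hL := appellSum_zero_zero_ne_zero u ht
  have hy2 (n : ℤ) : Complex.exp (2 * π * I * (u + 1 / 2 + 2 * n * t)) =
      -Complex.exp (2 * π * I * (u + 2 * n * t)) := by
    rw [show 2 * π * I * (u + 1 / 2 + 2 * n * t) = 2 * π * I * (u + 2 * n * t) + π * I by ring,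
      Complex.exp_add, Complex.exp_pi_mul_I]
    ring
  have hs2 (n : ℤ) : 1 - Complex.exp (2 * π * I * (u + 1 / 2 + 2 * n * t)) ≠ 0 := by
    have := h n
    rw [hy] at this
    rw [hy2]
    contrapose! this
    linear_combination (1 - Complex.exp (2 * π * I * (u + 2 * n * t))) * this
  have hα := (summable_appellTerm 0 1 ht hs1).hasSum
  have hβ := (summable_appellTerm 0 1 ht hs2).hasSum
  have h1 := ((hα.add hβ).mul_left (Complex.exp (-(9 * π * I * t / 4)) / 2)).of_eq
    (g := fun n : ℤ => (-1 : ℂ) ^ n * Complex.exp (π * I * ((n : ℂ) ^ 2 + (n : ℂ)) * (4 * t) +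
      2 * π * I * t * (n : ℂ)) / (1 - Complex.exp (2 * π * I * (n : ℂ) * (4 * t) +
        2 * π * I * (2 * u)))) (fun n => by
      have e := hy n
      rw [show 2 * π * I * (2 * u + 2 * n * (2 * t)) =
        2 * π * I * (n : ℂ) * (4 * t) + 2 * π * I * (2 * u) by ring] at e
      have g0 := hs1 n
      have g1 := hs2 n
      rw [hy2] at g1
      rw [e, appellTerm, appellTerm, poleTerm, poleTerm, hy2,
        show π * I * ((n : ℂ) ^ 2 + (n : ℂ)) * (4 * t) + 2 * π * I * t * (n : ℂ) =
          -(9 * π * I * t / 4) + π * I * (2 * n + 3 / 2) ^ 2 * t by ring, Complex.exp_add]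
      generalize Complex.exp (2 * π * I * (u + 2 * n * t)) = y at *
      have g2 : 1 - y ^ 2 ≠ 0 := by
        have := mul_ne_zero g0 g1
        rwa [show (1 - y) * (1 - -y) = 1 - y ^ 2 by ring] at this
      rw [sub_neg_eq_add] at *
      field_simp
      ring) rfl
  have h2 := ((hα.sub hβ).mul_left
      (Complex.exp (-(9 * π * I * t / 4)) * Complex.exp (-(2 * π * I * u)) / 2)).of_eq
    (g := fun n : ℤ => (-1 : ℂ) ^ n * Complex.exp (π * I * ((n : ℂ) ^ 2 + (n : ℂ)) * (4 * t) +
      2 * π * I * (3 * t) * (n : ℂ)) / (1 - Complex.exp (2 * π * I * (n : ℂ) * (4 * t) +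
        2 * π * I * (2 * u)))) (fun n => by
      have e := hy n
      rw [show 2 * π * I * (2 * u + 2 * n * (2 * t)) =
        2 * π * I * (n : ℂ) * (4 * t) + 2 * π * I * (2 * u) by ring] at e
      have g0 := hs1 n
      have g1 := hs2 n
      rw [hy2] at g1
      rw [e, appellTerm, appellTerm, poleTerm, poleTerm, hy2,
        show π * I * ((n : ℂ) ^ 2 + (n : ℂ)) * (4 * t) + 2 * π * I * (3 * t) * (n : ℂ) =
          -(9 * π * I * t / 4) + (-(2 * π * I * u)) + π * I * (2 * n + 3 / 2) ^ 2 * t +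
            2 * π * I * (u + 2 * n * t) by ring, Complex.exp_add, Complex.exp_add, Complex.exp_add]
      generalize Complex.exp (2 * π * I * (u + 2 * n * t)) = y at *
      have g2 : 1 - y ^ 2 ≠ 0 := by
        have := mul_ne_zero g0 g1
        rwa [show (1 - y) * (1 - -y) = 1 - y ^ 2 by ring] at this
      rw [sub_neg_eq_add] at *
      field_simp
      ring) rfl
  rw [lerchBracket, lerchMu, lerchMu, h1.tsum_eq, h2.tsum_eq, jTheta_self u, jTheta_three_mul u]
  rw [show 3 * π * I * u - 9 * π * I * t / 4 = 2 * π * I * u + π * I * u + -(9 * π * I * t / 4) by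
      ring, show π * I * (2 * u) = 2 * π * I * u by ring,
    show 3 * π * I * u = 2 * π * I * u + π * I * u by ring,
    show -π * I * t / 4 = -(π * I * t / 4) by ring,
    show -9 * π * I * t / 4 = -(9 * π * I * t / 4) by ring,
    Complex.exp_neg (2 * π * I * u)]
  simp only [Complex.exp_add]
  rw [show ∑' n, appellTerm 0 1 n u t = appellSum 0 1 u t from rfl]
  have n1 := Complex.exp_ne_zero (2 * π * I * u)
  have n2 := Complex.exp_ne_zero (-(9 * π * I * t / 4))
  have n3 := Complex.exp_ne_zero (-(π * I * t / 4))
  generalize Complex.exp (2 * π * I * u) = a at *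
  generalize Complex.exp (π * I * u) = b at *
  field_simp
  ring

lemma eventually_regular {u t : ℂ} (ht : 0 < t.im)
    (h : ∀ n : ℤ, 1 - Complex.exp (2 * π * I * (2 * u + 2 * n * (2 * t))) ≠ 0) :
    ∀ᶠ p : ℂ × ℂ in nhds (u, t), 0 < p.2.im ∧
      ∀ n : ℤ, 1 - Complex.exp (2 * π * I * (2 * p.1 + 2 * n * (2 * p.2))) ≠ 0 := by
  have ht2 : 0 < (2 * t).im := by
    have : (2 * t).im = 2 * t.im := by simp
    rw [this]; positivity
  obtain ⟨C, hC⟩ := exists_norm_poleTerm_le ht2 Set.univ fun n _ => h n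
  have hc : Tendsto (fun p : ℂ × ℂ => (2 * p.1, 2 * p.2)) (nhds (u, t)) (nhds (2 * u, 2 * t)) :=
    Continuous.tendsto (f := fun p : ℂ × ℂ => (2 * p.1, 2 * p.2)) (by fun_prop) (u, t)
  have him : ∀ᶠ p : ℂ × ℂ in nhds (u, t), 0 < p.2.im :=
    ContinuousAt.eventually_lt (f := fun _ => (0 : ℝ)) (g := fun p : ℂ × ℂ => p.2.im)
      (by fun_prop) (Complex.continuous_im.comp continuous_snd).continuousAt ht
  filter_upwards [hc.eventually hC, him] with p h1 h2
  exact ⟨h2, fun n => (h1 n (Set.mem_univ n)).1⟩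

lemma regular_of_two_mul {u t : ℂ}
    (h : ∀ n : ℤ, 1 - Complex.exp (2 * π * I * (2 * u + 2 * n * (2 * t))) ≠ 0) (n : ℤ) :
    1 - Complex.exp (2 * π * I * (u + 2 * n * t)) ≠ 0 := by
  have hn := h n
  rw [show 2 * π * I * (2 * u + 2 * n * (2 * t)) = (2 : ℕ) * (2 * π * I * (u + 2 * n * t)) by
    push_cast; ring, Complex.exp_nat_mul] at hn
  contrapose! hn
  linear_combination (1 + Complex.exp (2 * π * I * (u + 2 * n * t))) * hn

/-- The Appell-type sum obtained by applying the heat operator to `appellSum 0 1`. -/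
def appellHeat (u t : ℂ) : ℂ :=
  appellSum 2 1 u t + 2 * (appellSum 1 2 u t - appellSum 1 1 u t) +
    (2 * appellSum 0 3 u t - 3 * appellSum 0 2 u t + appellSum 0 1 u t)

/-- The image of `lerchBracket` under the heat operator. -/
def bracketHeat (u t : ℂ) : ℂ :=
  -4 * π ^ 2 * Complex.exp (3 * π * I * u - 9 * π * I * t / 4) / (I * appellSum 0 0 u t) *
    (appellHeat u t - appellSum 2 0 u t / appellSum 0 0 u t * appellSum 0 1 u t)

lemma hasDerivAt_lerchBracket_snd {u t : ℂ} (ht : 0 < t.im)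
    (h : ∀ n : ℤ, 1 - Complex.exp (2 * π * I * (2 * u + 2 * n * (2 * t))) ≠ 0) :
    HasDerivAt (fun s => lerchBracket u s)
      (Complex.exp (3 * π * I * u - 9 * π * I * t / 4) / (I * appellSum 0 0 u t) * (π * I) *
        (appellSum 2 1 u t + 2 * (appellSum 1 2 u t - appellSum 1 1 u t) -
          3 * (appellSum 0 2 u t - appellSum 0 1 u t) - 9 / 4 * appellSum 0 1 u t -
          appellSum 2 0 u t / appellSum 0 0 u t * appellSum 0 1 u t)) t := by
  have hc : Tendsto (fun s : ℂ => (u, s)) (nhds t) (nhds (u, t)) :=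
    Continuous.tendsto (by fun_prop) t
  have he : (fun s => lerchBracket u s) =ᶠ[nhds t] fun s =>
      Complex.exp (3 * π * I * u - 9 * π * I * s / 4) *
      appellSum 0 1 u s / (I * appellSum 0 0 u s) := by
    filter_upwards [hc.eventually (eventually_regular ht h)] with s hs
    exact lerchBracket_eq hs.1 hs.2
  have hL := appellSum_zero_zero_ne_zero u ht
  have h1 := hasDerivAt_appellSum_snd 0 1 ht (regular_of_two_mul h)
  have h2 := hasDerivAt_appellSum_zero_right 0 (u := u) ht
  have h3 : HasDerivAt (fun s => 3 * π * I * u - 9 * π * I * s / 4) (-(9 * π * I / 4)) t := by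
    refine ((((hasDerivAt_id t).const_mul (9 * π * I : ℂ)).div_const 4).const_sub
      (3 * π * I * u)).congr_deriv ?_
    ring
  refine HasDerivAt.congr_of_eventuallyEq ?_ he
  refine ((h3.cexp.mul h1).div (h2.const_mul I) (mul_ne_zero Complex.I_ne_zero hL)).congr_deriv ?_
  simp only [Pi.mul_apply, Nat.cast_one, zero_add, Nat.reduceAdd]
  field_simp
  ring

lemma hasDerivAt_lerchBracket_fst {u t : ℂ} (ht : 0 < t.im)
    (h : ∀ n : ℤ, 1 - Complex.exp (2 * π * I * (2 * u + 2 * n * (2 * t))) ≠ 0) :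
    HasDerivAt (fun w => lerchBracket w t)
      (Complex.exp (3 * π * I * u - 9 * π * I * t / 4) *
        (appellSum 0 1 u t + 2 * appellSum 0 2 u t) / (I * appellSum 0 0 t t) * (π * I)) u := by
  have hc : Tendsto (fun w : ℂ => (w, t)) (nhds u) (nhds (u, t)) :=
    Continuous.tendsto (by fun_prop) u
  have he : (fun w => lerchBracket w t) =ᶠ[nhds u] fun w =>
      Complex.exp (3 * π * I * w - 9 * π * I * t / 4) *
      appellSum 0 1 w t / (I * appellSum 0 0 t t) := by
    filter_upwards [hc.eventually (eventually_regular ht h)] with w hw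
    rw [lerchBracket_eq hw.1 hw.2, appellSum_zero_right 0 w t]
  have h1 := hasDerivAt_appellSum_fst 0 1 ht (regular_of_two_mul h)
  have h3 : HasDerivAt (fun w => 3 * π * I * w - 9 * π * I * t / 4) (3 * π * I) u := by
    simpa using ((hasDerivAt_id u).const_mul (3 * π * I : ℂ)).sub_const (9 * π * I * t / 4)
  refine HasDerivAt.congr_of_eventuallyEq ?_ he
  refine ((h3.cexp.mul h1).div_const _).congr_deriv ?_
  simp only [Nat.cast_one, Nat.reduceAdd]
  ring

lemma heat_lerchBracket {u t : ℂ} (ht : 0 < t.im)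
    (h : ∀ n : ℤ, 1 - Complex.exp (2 * π * I * (2 * u + 2 * n * (2 * t))) ≠ 0) :
    4 * π * I * deriv (fun s => lerchBracket u s) t +
      iteratedDeriv 2 (fun w => lerchBracket w t) u = bracketHeat u t := by
  have hc : Tendsto (fun w : ℂ => (w, t)) (nhds u) (nhds (u, t)) :=
    Continuous.tendsto (by fun_prop) u
  have he : deriv (fun w => lerchBracket w t) =ᶠ[nhds u] fun w =>
      Complex.exp (3 * π * I * w - 9 * π * I * t / 4) *
        (appellSum 0 1 w t + 2 * appellSum 0 2 w t) / (I * appellSum 0 0 t t) * (π * I) := by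
    filter_upwards [hc.eventually (eventually_regular ht h)] with w hw
    exact (hasDerivAt_lerchBracket_fst hw.1 hw.2).deriv
  have h1 := hasDerivAt_appellSum_fst 0 1 ht (regular_of_two_mul h)
  have h2 := hasDerivAt_appellSum_fst 0 2 ht (regular_of_two_mul h)
  have h3 : HasDerivAt (fun w => 3 * π * I * w - 9 * π * I * t / 4) (3 * π * I) u := by
    simpa using ((hasDerivAt_id u).const_mul (3 * π * I : ℂ)).sub_const (9 * π * I * t / 4)
  have h4 := (((h3.cexp.mul (h1.add (h2.const_mul 2))).div_const (I * appellSum 0 0 t t)).mul_const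
    (π * I : ℂ)).deriv
  rw [iteratedDeriv_succ, iteratedDeriv_one, he.deriv_eq,
    (hasDerivAt_lerchBracket_snd ht h).deriv]
  refine (congrArg _ h4).trans ?_
  have hL := appellSum_zero_zero_ne_zero t ht
  rw [bracketHeat, appellHeat, appellSum_zero_right 0 u t]
  simp only [Pi.add_apply, Nat.cast_one, Nat.cast_ofNat, Nat.reduceAdd]
  field_simp
  ring_nf
  simp only [Complex.I_sq]
  ring

lemma poleTerm_add_one (n : ℤ) (u t : ℂ) : poleTerm n (u + 1) t = poleTerm n u t := by
  rw [poleTerm, poleTerm, show 2 * π * I * (u + 1 + 2 * n * t) =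
    2 * π * I * (u + 2 * n * t) + 2 * π * I by ring, Complex.exp_add, Complex.exp_two_pi_mul_I,
    mul_one]

lemma poleTerm_sub_one_add_two_mul (n : ℤ) (u t : ℂ) :
    poleTerm (n - 1) (u + 2 * t) t = poleTerm n u t := by
  rw [poleTerm, poleTerm]
  congr 4
  push_cast
  ring

lemma appellSum_add_one (k j : ℕ) (u t : ℂ) : appellSum k j (u + 1) t = appellSum k j u t :=
  tsum_congr fun n => by rw [appellTerm, appellTerm, poleTerm_add_one]

lemma bracketHeat_add_one (u t : ℂ) : bracketHeat (u + 1) t = -bracketHeat u t := by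
  have h : Complex.exp (3 * π * I * (u + 1) - 9 * π * I * t / 4) =
      -Complex.exp (3 * π * I * u - 9 * π * I * t / 4) := by
    rw [show 3 * π * I * (u + 1) - 9 * π * I * t / 4 =
      3 * π * I * u - 9 * π * I * t / 4 + π * I + 2 * π * I by ring, Complex.exp_add,
      Complex.exp_two_pi_mul_I, Complex.exp_add, Complex.exp_pi_mul_I]
    ring
  simp only [bracketHeat, appellHeat, appellSum_add_one, h]
  ring

lemma hasSum_appellTerm_zero (k : ℕ) (u : ℂ) {t : ℂ} (ht : 0 < t.im) :
    HasSum (fun n => appellTerm k 0 n u t) (appellSum k 0 u t) := by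
  simp only [appellTerm_zero_right k _ u t, appellSum_zero_right k u t]
  exact (summable_appellTerm k 0 ht (one_sub_exp_self_ne_zero ht)).hasSum

lemma hasSum_appellTerm_zero_shift_one {k : ℕ} (hk : Even k) (u : ℂ) {t : ℂ} (ht : 0 < t.im) :
    HasSum (fun n : ℤ => (-1 : ℂ) ^ n * (2 * n + 3 / 2 - 1) ^ k *
        Complex.exp (π * I * (2 * n + 3 / 2) ^ 2 * t) *
        (Complex.exp (2 * π * I * (u + 2 * n * t)))⁻¹)
      (-((Complex.exp (2 * π * I * u))⁻¹ * Complex.exp (2 * π * I * t)) *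
        appellSum k 0 u t) := by
  have h := ((((Equiv.neg ℤ).trans (Equiv.subRight 1)).hasSum_iff).2
    (hasSum_appellTerm_zero k u ht)).mul_left
      (-((Complex.exp (2 * π * I * u))⁻¹ * Complex.exp (2 * π * I * t)))
  refine h.of_eq (fun n => ?_) rfl
  simp only [Function.comp_apply, Equiv.trans_apply, Equiv.neg_apply, Equiv.subRight_apply,
    appellTerm, pow_zero, mul_one]
  have e1 : (-1 : ℂ) ^ (-n - 1) = -(-1) ^ n := by
    rw [zpow_sub₀ (by norm_num), zpow_neg]
    rcases Int.even_or_odd n with h | h <;> simp [h.neg_one_zpow]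
  have e2 : (2 * ((-n - 1 : ℤ) : ℂ) + 3 / 2) ^ k = (2 * n + 3 / 2 - 1) ^ k := by
    rw [← hk.neg_pow]
    congr 1
    push_cast
    ring
  have e3 : Complex.exp (π * I * (2 * n + 3 / 2) ^ 2 * t) *
        (Complex.exp (2 * π * I * (u + 2 * n * t)))⁻¹ =
      (Complex.exp (2 * π * I * u))⁻¹ * Complex.exp (2 * π * I * t) *
        Complex.exp (π * I * (2 * ((-n - 1 : ℤ) : ℂ) + 3 / 2) ^ 2 * t) := by
    rw [← Complex.exp_neg, ← Complex.exp_neg, ← Complex.exp_add, ← Complex.exp_add,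
      ← Complex.exp_add]
    congr 1
    push_cast
    ring
  rw [e1, e2, mul_assoc, e3]
  ring

lemma neg_one_zpow_sub_one (n : ℤ) : (-1 : ℂ) ^ (n - 1) = -(-1) ^ n := by
  rw [zpow_sub₀ (by norm_num)]
  simp [div_neg]

lemma hasSum_appellTerm_zero_shift_two (k : ℕ) (u : ℂ) {t : ℂ} (ht : 0 < t.im) :
    HasSum (fun n : ℤ => (-1 : ℂ) ^ n * (2 * n + 3 / 2 - 2) ^ k *
        Complex.exp (π * I * (2 * n + 3 / 2) ^ 2 * t) *
        (Complex.exp (2 * π * I * (u + 2 * n * t)))⁻¹ ^ 2)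
      (-((Complex.exp (2 * π * I * u))⁻¹ ^ 2 * Complex.exp (2 * π * I * t)) *
        appellSum k 0 u t) := by
  have h := ((Equiv.subRight (1 : ℤ)).hasSum_iff.2
    (hasSum_appellTerm_zero k u ht)).mul_left
      (-((Complex.exp (2 * π * I * u))⁻¹ ^ 2 * Complex.exp (2 * π * I * t)))
  refine h.of_eq (fun n => ?_) rfl
  simp only [Function.comp_apply, Equiv.subRight_apply, appellTerm, pow_zero, mul_one]
  have e2 : (2 * ((n - 1 : ℤ) : ℂ) + 3 / 2) ^ k = (2 * n + 3 / 2 - 2) ^ k := by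
    congr 1
    push_cast
    ring
  have e3 : Complex.exp (π * I * (2 * n + 3 / 2) ^ 2 * t) *
        (Complex.exp (2 * π * I * (u + 2 * n * t)))⁻¹ ^ 2 =
      (Complex.exp (2 * π * I * u))⁻¹ ^ 2 * Complex.exp (2 * π * I * t) *
        Complex.exp (π * I * (2 * ((n - 1 : ℤ) : ℂ) + 3 / 2) ^ 2 * t) := by
    rw [← Complex.exp_neg, ← Complex.exp_neg, ← Complex.exp_nat_mul, ← Complex.exp_nat_mul,
      ← Complex.exp_add, ← Complex.exp_add, ← Complex.exp_add]
    congr 1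
    push_cast
    ring
  rw [neg_one_zpow_sub_one, e2, mul_assoc, e3]
  ring

/-- The terms of `appellHeat`. -/
def appellHeatTerm (n : ℤ) (u t : ℂ) : ℂ :=
  appellTerm 2 1 n u t + 2 * (appellTerm 1 2 n u t - appellTerm 1 1 n u t) +
    (2 * appellTerm 0 3 n u t - 3 * appellTerm 0 2 n u t + appellTerm 0 1 n u t)

lemma hasSum_appellHeatTerm {u t : ℂ} (ht : 0 < t.im)
    (h : ∀ n : ℤ, 1 - Complex.exp (2 * π * I * (u + 2 * n * t)) ≠ 0) :
    HasSum (fun n => appellHeatTerm n u t) (appellHeat u t) := by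
  have hs (k j : ℕ) : HasSum (fun n => appellTerm k j n u t) (appellSum k j u t) :=
    (summable_appellTerm k j ht h).hasSum
  exact ((hs 2 1).add (((hs 1 2).sub (hs 1 1)).mul_left 2)).add
    ((((hs 0 3).mul_left 2).sub ((hs 0 2).mul_left 3)).add (hs 0 1))

lemma exp_sub_one_shift (n : ℤ) (u t : ℂ) :
    Complex.exp (π * I * (2 * ((n - 1 : ℤ) : ℂ) + 3 / 2) ^ 2 * t) =
      Complex.exp (2 * π * I * u) ^ 2 * (Complex.exp (2 * π * I * t))⁻¹ *
        (Complex.exp (π * I * (2 * n + 3 / 2) ^ 2 * t) *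
          (Complex.exp (2 * π * I * (u + 2 * n * t)))⁻¹ ^ 2) := by
  rw [← Complex.exp_neg, ← Complex.exp_neg, ← Complex.exp_nat_mul, ← Complex.exp_nat_mul,
    ← Complex.exp_add, ← Complex.exp_add, ← Complex.exp_add]
  congr 1
  push_cast
  ring

lemma regular_add_two_mul {u t : ℂ}
    (h : ∀ n : ℤ, 1 - Complex.exp (2 * π * I * (u + 2 * n * t)) ≠ 0) (n : ℤ) :
    1 - Complex.exp (2 * π * I * (u + 2 * t + 2 * n * t)) ≠ 0 := by
  have := h (n + 1)
  rwa [show u + 2 * ((n + 1 : ℤ) : ℂ) * t = u + 2 * t + 2 * n * t by push_cast; ring] at this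

lemma appellSum_zero_one_add_two_mul {u t : ℂ} (ht : 0 < t.im)
    (h : ∀ n : ℤ, 1 - Complex.exp (2 * π * I * (u + 2 * n * t)) ≠ 0) :
    appellSum 0 1 (u + 2 * t) t =
      -(Complex.exp (2 * π * I * u) ^ 2 * (Complex.exp (2 * π * I * t))⁻¹) *
        (appellSum 0 1 u t + -((Complex.exp (2 * π * I * u))⁻¹ * Complex.exp (2 * π * I * t)) *
          appellSum 0 0 u t + -((Complex.exp (2 * π * I * u))⁻¹ ^ 2 * Complex.exp (2 * π * I * t)) *
          appellSum 0 0 u t) := by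
  have h1 := (Equiv.subRight (1 : ℤ)).hasSum_iff.2
    (summable_appellTerm 0 1 ht (regular_add_two_mul h)).hasSum
  refine h1.unique ((((((summable_appellTerm 0 1 ht h).hasSum.add
    (hasSum_appellTerm_zero_shift_one (k := 0) (by simp) u ht)).add
    (hasSum_appellTerm_zero_shift_two 0 u ht)).mul_left _).of_eq (fun n => ?_) rfl))
  simp only [Function.comp_apply, Equiv.subRight_apply, appellTerm, poleTerm_sub_one_add_two_mul,
    exp_sub_one_shift n u t, neg_one_zpow_sub_one, pow_zero, pow_one, mul_one]
  simp only [poleTerm]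
  have hn := h n
  have h0 := Complex.exp_ne_zero (2 * π * I * (u + 2 * n * t))
  generalize Complex.exp (2 * π * I * (u + 2 * n * t)) = y at *
  field_simp
  ring

lemma appellHeat_add_two_mul {u t : ℂ} (ht : 0 < t.im)
    (h : ∀ n : ℤ, 1 - Complex.exp (2 * π * I * (u + 2 * n * t)) ≠ 0) :
    appellHeat (u + 2 * t) t =
      -(Complex.exp (2 * π * I * u) ^ 2 * (Complex.exp (2 * π * I * t))⁻¹) *
        (appellHeat u t + -((Complex.exp (2 * π * I * u))⁻¹ * Complex.exp (2 * π * I * t)) *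
          appellSum 2 0 u t + -((Complex.exp (2 * π * I * u))⁻¹ ^ 2 * Complex.exp (2 * π * I * t)) *
          appellSum 2 0 u t) := by
  have h1 := (Equiv.subRight (1 : ℤ)).hasSum_iff.2
    (hasSum_appellHeatTerm ht (regular_add_two_mul h))
  refine h1.unique ((((((hasSum_appellHeatTerm ht h).add
    (hasSum_appellTerm_zero_shift_one (k := 2) (by simp) u ht)).add
    (hasSum_appellTerm_zero_shift_two 2 u ht)).mul_left _).of_eq (fun n => ?_) rfl))
  simp only [Function.comp_apply, Equiv.subRight_apply, appellTerm, appellHeatTerm,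
    poleTerm_sub_one_add_two_mul,
    exp_sub_one_shift n u t, neg_one_zpow_sub_one, pow_zero, pow_one, mul_one]
  simp only [poleTerm]
  push_cast
  have hn := h n
  have h0 := Complex.exp_ne_zero (2 * π * I * (u + 2 * n * t))
  generalize Complex.exp (2 * π * I * (u + 2 * n * t)) = y at *
  field_simp
  ring

lemma bracketHeat_add_two_mul {u t : ℂ} (ht : 0 < t.im)
    (h : ∀ n : ℤ, 1 - Complex.exp (2 * π * I * (u + 2 * n * t)) ≠ 0) :
    bracketHeat (u + 2 * t) t = -(Complex.exp (2 * π * I * u) ^ 2 * Complex.exp (2 * π * I * t) ^ 2) *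
      bracketHeat u t := by
  have hE : Complex.exp (3 * π * I * (u + 2 * t) - 9 * π * I * t / 4) =
      Complex.exp (3 * π * I * u - 9 * π * I * t / 4) * Complex.exp (2 * π * I * t) ^ 3 := by
    rw [← Complex.exp_nat_mul, ← Complex.exp_add]
    congr 1
    push_cast
    ring
  have hL := appellSum_zero_zero_ne_zero u ht
  have hz := Complex.exp_ne_zero (2 * π * I * u)
  have hq := Complex.exp_ne_zero (2 * π * I * t)
  rw [bracketHeat, bracketHeat, appellHeat_add_two_mul ht h, appellSum_zero_one_add_two_mul ht h,
    appellSum_zero_right 0 (u + 2 * t) u, appellSum_zero_right 2 (u + 2 * t) u, hE]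
  field_simp
  ring

/-- The lattice spanned by `1` and `w`. -/
def latticeSet (w : ℂ) : Set ℂ := {u | ∃ m n : ℤ, u = n + m * w}

lemma countable_latticeSet (w : ℂ) : (latticeSet w).Countable := by
  have : latticeSet w = Set.range fun p : ℤ × ℤ => (p.2 : ℂ) + p.1 * w := by
    ext u
    simp [latticeSet, eq_comm]
  rw [this]
  exact Set.countable_range _

lemma dense_compl_latticeSet (w : ℂ) : Dense (latticeSet w)ᶜ :=
  (countable_latticeSet w).dense_compl ℝ

lemma add_mem_latticeSet {w : ℂ} (u : ℂ) (m n : ℤ) :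
    u + n + m * w ∈ latticeSet w ↔ u ∈ latticeSet w := by
  constructor
  · rintro ⟨a, b, h⟩
    exact ⟨a - m, b - n, by push_cast; linear_combination h⟩
  · rintro ⟨a, b, h⟩
    exact ⟨a + m, b + n, by push_cast; linear_combination h⟩

lemma eventually_notMem_latticeSet {w : ℂ} {Θ : ℂ → ℂ} (hΘ : Differentiable ℂ Θ)
    (hz : ∀ u, Θ u = 0 ↔ u ∈ latticeSet w) (c : ℂ) :
    ∀ᶠ u in nhdsWithin c {c}ᶜ, u ∉ latticeSet w := by
  rcases (hΘ.analyticAt c).eventually_eq_zero_or_eventually_ne_zero with h | h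
  · obtain ⟨u, hu, hu'⟩ := (dense_compl_latticeSet w).inter_nhds_nonempty h
    exact (hu ((hz u).1 hu')).elim
  · filter_upwards [h] with u hu hmem
    exact hu ((hz u).2 hmem)

lemma exists_bound_of_norm_periodic {w : ℂ} (hw : 0 < w.im) {D : ℂ → ℂ} (hD : Continuous D)
    (h1 : Function.Periodic (fun u => ‖D u‖) 1) (h2 : Function.Periodic (fun u => ‖D u‖) w) :
    ∃ C, ∀ u, ‖D u‖ ≤ C := by
  have hK : IsCompact ((fun p : ℝ × ℝ => (p.1 + p.2 * w : ℂ)) '' (Set.Icc 0 1 ×ˢ Set.Icc 0 1)) :=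
    (isCompact_Icc.prod isCompact_Icc).image (by fun_prop)
  obtain ⟨C, hC⟩ := hK.exists_bound_of_continuousOn hD.continuousOn
  refine ⟨C, fun u => ?_⟩
  set b := u.im / w.im
  set a := u.re - b * w.re
  have hu : u = Int.fract a + Int.fract b * w + ⌊a⌋ * 1 + ⌊b⌋ * w := by
    have e : u = a + b * w := by
      apply Complex.ext
      · simp [a]
      · simp [b, hw.ne']
    have ea : (a : ℂ) = ⌊a⌋ + Int.fract a := by exact_mod_cast (Int.floor_add_fract a).symm
    have eb : (b : ℂ) = ⌊b⌋ + Int.fract b := by exact_mod_cast (Int.floor_add_fract b).symm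
    linear_combination e + ea + w * eb
  have h3 := h1.int_mul ⌊a⌋ (Int.fract a + Int.fract b * w)
  have h4 := h2.int_mul ⌊b⌋ (Int.fract a + Int.fract b * w + ⌊a⌋ * 1)
  rw [hu, h4, h3]
  exact hC _ ⟨(Int.fract a, Int.fract b), ⟨⟨Int.fract_nonneg _, (Int.fract_lt_one _).le⟩,
    ⟨Int.fract_nonneg _, (Int.fract_lt_one _).le⟩⟩, rfl⟩

lemma norm_add_lattice {w : ℂ} {d : ℂ → ℂ}
    (h1 : ∀ u ∉ latticeSet w, d (u + 1) = -d u) (h2 : ∀ u ∉ latticeSet w, d (u + w) = -d u)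
    (m n : ℤ) {u : ℂ} (hu : u ∉ latticeSet w) : ‖d (u + n + m * w)‖ = ‖d u‖ := by
  classical
  have hsplit (u : ℂ) (m n : ℤ) : u + n + m * w ∈ latticeSet w ↔ u ∈ latticeSet w :=
    add_mem_latticeSet u m n
  let g : ℂ → ℝ := fun u => if u ∈ latticeSet w then 0 else ‖d u‖
  have g1 : Function.Periodic g 1 := fun v => by
    have := hsplit v 0 1
    simp only [Int.cast_one, Int.cast_zero, zero_mul, add_zero] at this
    by_cases hv : v ∈ latticeSet w
    · simp only [g, this, hv, if_true]
    · simp only [g, this, hv, if_false, h1 v hv, norm_neg]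
  have g2 : Function.Periodic g w := fun v => by
    have := hsplit v 1 0
    simp only [Int.cast_one, Int.cast_zero, one_mul, add_zero] at this
    by_cases hv : v ∈ latticeSet w
    · simp only [g, this, hv, if_true]
    · simp only [g, this, hv, if_false, h2 v hv, norm_neg]
  have h3 := g1.int_mul n u
  have h4 := g2.int_mul m (u + n * 1)
  rw [mul_one] at h3 h4
  have h5 := h4.trans h3
  simpa only [g, hsplit, hu, if_false] using h5

lemma eq_zero_of_antiperiodic {w : ℂ} (hw : 0 < w.im) {Θ d : ℂ → ℂ} (hΘ : Differentiable ℂ Θ)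
    (hz : ∀ u, Θ u = 0 ↔ u ∈ latticeSet w)
    (hd : ∀ u ∉ latticeSet w, DifferentiableAt ℂ d u)
    (h1 : ∀ u ∉ latticeSet w, d (u + 1) = -d u) (h2 : ∀ u ∉ latticeSet w, d (u + w) = -d u)
    (h0 : Tendsto (fun u => u * d u) (nhdsWithin 0 {0}ᶜ) (nhds 0))
    {u : ℂ} (hu : u ∉ latticeSet w) : d u = 0 := by
  have hev := eventually_notMem_latticeSet hΘ hz
  have hlim (c : ℂ) : Tendsto (fun z => (z - c) * d z) (nhdsWithin c {c}ᶜ) (nhds 0) := by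
    by_cases hc : c ∈ latticeSet w
    · obtain ⟨m, n, rfl⟩ := hc
      set c : ℂ := n + m * w with hc
      have ht : Tendsto (fun z => z - c) (nhdsWithin c {c}ᶜ) (nhdsWithin 0 {0}ᶜ) := by
        refine tendsto_nhdsWithin_iff.2 ⟨?_, ?_⟩
        · have : Tendsto (fun z => z - c) (nhds c) (nhds (c - c)) :=
            Continuous.tendsto (by fun_prop) c
          rw [sub_self] at this
          exact this.mono_left nhdsWithin_le_nhds
        · filter_upwards [self_mem_nhdsWithin] with z hz
          simpa [sub_eq_zero] using hz
      rw [tendsto_zero_iff_norm_tendsto_zero] at h0 ⊢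
      refine (h0.comp ht).congr' ?_
      filter_upwards [ht.eventually (hev 0)] with z hz
      have := norm_add_lattice h1 h2 m n hz
      rw [Function.comp_apply, norm_mul, norm_mul, ← this, hc]
      congr 3
      ring
    · have : Tendsto (fun z => (z - c) * d z) (nhds c) (nhds ((c - c) * d c)) :=
        ((continuous_id.sub continuous_const).tendsto c).mul (hd c hc).continuousAt
      rw [sub_self, zero_mul] at this
      exact this.mono_left nhdsWithin_le_nhds
  set D : ℂ → ℂ := fun c => limUnder (nhdsWithin c {c}ᶜ) d with hDdef
  have hDd (c : ℂ) (hc : c ∉ latticeSet w) : D c = d c :=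
    ((hd c hc).continuousAt.tendsto.mono_left nhdsWithin_le_nhds).limUnder_eq
  have hD : Differentiable ℂ D := by
    intro c
    have hs : {z | z ∉ latticeSet w} ∪ {c} ∈ nhds c := by
      have := eventually_nhdsWithin_iff.1 (hev c)
      filter_upwards [this] with z hz
      by_cases hzc : z = c
      · exact Or.inr hzc
      · exact Or.inl (hz hzc)
    have hdiff : DifferentiableOn ℂ d (({z | z ∉ latticeSet w} ∪ {c}) \ {c}) := by
      rintro z ⟨hz | hz, hzc⟩
      · exact (hd z hz).differentiableWithinAt
      · exact (hzc hz).elim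
    have ho : (fun z => d z - d c) =o[nhdsWithin c {c}ᶜ] fun z => (z - c)⁻¹ := by
      rw [Asymptotics.isLittleO_iff_tendsto']
      · have hcc : Tendsto (fun z => (z - c) * d c) (nhdsWithin c {c}ᶜ) (nhds 0) := by
          have : Tendsto (fun z => (z - c) * d c) (nhds c) (nhds ((c - c) * d c)) :=
            Continuous.tendsto (by fun_prop) c
          rw [sub_self, zero_mul] at this
          exact this.mono_left nhdsWithin_le_nhds
        have := (hlim c).sub hcc
        rw [sub_zero] at this
        refine this.congr fun z => ?_
        rw [div_inv_eq_mul]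
        ring
      · filter_upwards [self_mem_nhdsWithin] with z hz h
        exact (hz (sub_eq_zero.1 (inv_eq_zero.1 h))).elim
    have hup := (Complex.differentiableOn_update_limUnder_of_isLittleO hs hdiff ho).differentiableAt hs
    refine hup.congr_of_eventuallyEq ?_
    filter_upwards [hs] with z hz
    by_cases hzc : z = c
    · rw [hzc, Function.update_self]
    · rw [Function.update_of_ne hzc]
      exact hDd z (hz.resolve_right hzc)
  have hadd1 : (fun u => D (u + 1)) = fun u => -D u := by
    refine Continuous.ext_on (dense_compl_latticeSet w) (hD.continuous.comp (by fun_prop))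
      hD.continuous.neg fun v hv => ?_
    have := add_mem_latticeSet (w := w) v 0 1
    simp only [Int.cast_one, Int.cast_zero, zero_mul, add_zero] at this
    rw [hDd v hv, hDd _ (this.not.2 hv), h1 v hv]
  have hadd2 : (fun u => D (u + w)) = fun u => -D u := by
    refine Continuous.ext_on (dense_compl_latticeSet w) (hD.continuous.comp (by fun_prop))
      hD.continuous.neg fun v hv => ?_
    have := add_mem_latticeSet (w := w) v 1 0
    simp only [Int.cast_one, Int.cast_zero, one_mul, add_zero] at this
    rw [hDd v hv, hDd _ (this.not.2 hv), h2 v hv]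
  obtain ⟨C, hC⟩ := exists_bound_of_norm_periodic hw hD.continuous
    (fun v => by simp only [congrFun hadd1 v, norm_neg])
    (fun v => by simp only [congrFun hadd2 v, norm_neg])
  have hbd : Bornology.IsBounded (Set.range D) :=
    isBounded_iff_forall_norm_le.2 ⟨C, by rintro _ ⟨v, rfl⟩; exact hC v⟩
  have e1 : D (u + 1) = D u := hD.apply_eq_apply_of_bounded hbd _ _
  have e2 : D (u + 1) = -D u := congrFun hadd1 u
  rw [← hDd u hu]
  exact self_eq_neg.1 (e1.symm.trans e2)

lemma two_mul_im_pos {t : ℂ} (ht : 0 < t.im) : 0 < (2 * t).im := by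
  have : (2 * t).im = 2 * t.im := by simp
  rw [this]
  positivity

lemma norm_exp_two_pi_mul_I_lt_one {t : ℂ} (ht : 0 < t.im) :
    ‖Complex.exp (2 * π * I * t)‖ < 1 := by
  have := norm_exp_pi_mul_I_lt_one (two_mul_im_pos ht)
  rwa [show (π : ℂ) * I * (2 * t) = 2 * π * I * t by ring] at this

/-- The odd theta function with nome `exp (2 * π * I * t)`, up to a constant factor. -/
def oddTheta (u t : ℂ) : ℂ :=
  Complex.exp (π * I * u) * jacobiTheta₂ (u + 1 / 2 + t) (2 * t)

lemma jTheta_two_mul (u t : ℂ) :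
    jTheta u (2 * t) = I * Complex.exp (π * I * t / 2) * oddTheta u t := by
  rw [jTheta_eq_jacobiTheta₂, oddTheta, show 2 * t / 2 = t by ring,
    show π * I * (2 * t) / 4 = π * I * t / 2 by ring]

lemma differentiable_oddTheta {t : ℂ} (ht : 0 < t.im) : Differentiable ℂ fun u => oddTheta u t := by
  intro u
  have h1 := (differentiableAt_jacobiTheta₂_fst (u + 1 / 2 + t) (two_mul_im_pos ht))
  have h2 : DifferentiableAt ℂ (fun u : ℂ => u + 1 / 2 + t) u := by fun_prop
  have h3 : DifferentiableAt ℂ (fun u : ℂ => Complex.exp (π * I * u)) u := by fun_prop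
  exact h3.mul (DifferentiableAt.fun_comp' u h1 h2)

lemma oddTheta_add_one (u t : ℂ) : oddTheta (u + 1) t = -oddTheta u t := by
  rw [oddTheta, oddTheta, show u + 1 + 1 / 2 + t = u + 1 / 2 + t + 1 by ring,
    jacobiTheta₂_add_left, mul_add, Complex.exp_add, mul_one, Complex.exp_pi_mul_I]
  ring

lemma oddTheta_add_two_mul (u t : ℂ) : oddTheta (u + 2 * t) t =
    -((Complex.exp (2 * π * I * t))⁻¹ * (Complex.exp (2 * π * I * u))⁻¹) * oddTheta u t := by
  rw [oddTheta, oddTheta, show u + 2 * t + 1 / 2 + t = u + 1 / 2 + t + 2 * t by ring,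
    jacobiTheta₂_add_left', ← mul_assoc, ← mul_assoc]
  congr 1
  have e : Complex.exp (π * I * (u + 2 * t)) *
      Complex.exp (-π * I * (2 * t + 2 * (u + 1 / 2 + t))) =
      Complex.exp (-(2 * π * I * t)) * Complex.exp (-(2 * π * I * u)) *
        Complex.exp (π * I * u) * Complex.exp (-(π * I)) := by
    simp only [← Complex.exp_add]
    congr 1
    ring
  rw [e, Complex.exp_neg (π * I), Complex.exp_pi_mul_I, Complex.exp_neg, Complex.exp_neg]
  ring

lemma oddTheta_eq (u : ℂ) {t : ℂ} (ht : 0 < t.im) : oddTheta u t =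
    Complex.exp (π * I * u) * (1 - (Complex.exp (2 * π * I * u))⁻¹) *
      (qPochInf (Complex.exp (2 * π * I * t) ^ 2) (Complex.exp (2 * π * I * t) ^ 2) *
        (qPochInf (Complex.exp (2 * π * I * u) * Complex.exp (2 * π * I * t) ^ 2)
            (Complex.exp (2 * π * I * t) ^ 2) *
          qPochInf ((Complex.exp (2 * π * I * u))⁻¹ * Complex.exp (2 * π * I * t) ^ 2)
            (Complex.exp (2 * π * I * t) ^ 2))) := by
  have e1 : Complex.exp (π * I * (2 * t)) = Complex.exp (2 * π * I * t) := by
    congr 1; ring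
  have e2 : Complex.exp (2 * π * I * (u + 1 / 2 + t)) =
      -(Complex.exp (2 * π * I * u) * Complex.exp (2 * π * I * t)) := by
    rw [show (2 * π * I * (u + 1 / 2 + t) : ℂ) = 2 * π * I * u + 2 * π * I * t + π * I by
      ring, Complex.exp_add, Complex.exp_pi_mul_I, Complex.exp_add]
    ring
  have hq := norm_exp_two_pi_mul_I_lt_one ht
  have hq0 := Complex.exp_ne_zero (2 * π * I * t)
  rw [oddTheta, jacobiTheta₂_eq_qPochInf _ (two_mul_im_pos ht), e1, e2]
  generalize Complex.exp (2 * π * I * t) = q at *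
  have hz0 := Complex.exp_ne_zero (2 * π * I * u)
  generalize Complex.exp (2 * π * I * u) = z at *
  have hq2 : ‖q ^ 2‖ < 1 := by
    rw [norm_pow]; exact pow_lt_one₀ (norm_nonneg _) hq (by norm_num)
  rw [show -(-(z * q) * q) = z * q ^ 2 by ring, show -((-(z * q))⁻¹ * q) = z⁻¹ by field_simp,
    qPochInf_eq_mul hq2 z⁻¹]
  ring

lemma exp_shift_eq (n : ℤ) (u t : ℂ) : Complex.exp (2 * π * I * (u + 2 * n * t)) =
    Complex.exp (2 * π * I * u) * (Complex.exp (2 * π * I * t) ^ 2) ^ n := by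
  rw [← Complex.exp_nat_mul, ← Complex.exp_int_mul, ← Complex.exp_add]
  congr 1
  push_cast
  ring

lemma oddTheta_eq_zero_iff (u : ℂ) {t : ℂ} (ht : 0 < t.im) :
    oddTheta u t = 0 ↔ ∃ n : ℤ, 1 - Complex.exp (2 * π * I * (u + 2 * n * t)) = 0 := by
  have hq := norm_exp_two_pi_mul_I_lt_one ht
  simp only [oddTheta_eq u ht, exp_shift_eq]
  have hq0 := Complex.exp_ne_zero (2 * π * I * t)
  generalize Complex.exp (2 * π * I * t) = q at *
  have hz0 := Complex.exp_ne_zero (2 * π * I * u)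
  generalize Complex.exp (2 * π * I * u) = z at *
  have hq2 : ‖q ^ 2‖ < 1 := by
    rw [norm_pow]; exact pow_lt_one₀ (norm_nonneg _) hq (by norm_num)
  have hp0 : q ^ 2 ≠ 0 := pow_ne_zero 2 hq0
  generalize q ^ 2 = p at *
  constructor
  · intro h
    by_contra! hn
    have a1 : 1 - z⁻¹ ≠ 0 := by
      have := hn 0
      contrapose! this
      have : z = 1 := inv_eq_one.1 (sub_eq_zero.1 this).symm
      simp [this]
    have a2 : qPochInf (z * p) p ≠ 0 := qPochInf_ne_zero hq2 fun j => by
      have := hn (j + 1)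
      rwa [zpow_add_one₀ hp0, zpow_natCast, mul_comm _ p, ← mul_assoc] at this
    have a3 : qPochInf (z⁻¹ * p) p ≠ 0 := qPochInf_ne_zero hq2 fun j => by
      have := hn (-(j + 1))
      contrapose! this
      rw [zpow_neg, zpow_add_one₀ hp0, zpow_natCast]
      have h2 : z⁻¹ * p * p ^ j = 1 := (sub_eq_zero.1 this).symm
      have h3 : p ^ j * p = z := by
        rw [← mul_one z, ← h2]
        field_simp
      rw [h3, mul_inv_cancel₀ hz0, sub_self]
    exact mul_ne_zero (mul_ne_zero (Complex.exp_ne_zero _) a1)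
      (mul_ne_zero (qPochInf_self_ne_zero hq2) (mul_ne_zero a2 a3)) h
  · rintro ⟨n, hn⟩
    rcases lt_trichotomy n 0 with h | rfl | h
    · obtain ⟨j, rfl⟩ : ∃ j : ℕ, n = -(j + 1) := ⟨(-n - 1).toNat, by omega⟩
      rw [zpow_neg, zpow_add_one₀ hp0, zpow_natCast] at hn
      have : 1 - z⁻¹ * p * p ^ j = 0 := by
        have h2 : z * (p ^ j * p)⁻¹ = 1 := (sub_eq_zero.1 hn).symm
        rw [sub_eq_zero, show z⁻¹ * p * p ^ j = (z * (p ^ j * p)⁻¹)⁻¹ by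
          rw [mul_inv, inv_inv]; ring, h2, inv_one]
      rw [qPochInf_eq_zero this]
      simp
    · have : z = 1 := by
        rw [zpow_zero, mul_one] at hn
        exact (sub_eq_zero.1 hn).symm
      simp [this]
    · obtain ⟨j, rfl⟩ : ∃ j : ℕ, n = j + 1 := ⟨(n - 1).toNat, by omega⟩
      rw [zpow_add_one₀ hp0, zpow_natCast, mul_comm _ p, ← mul_assoc] at hn
      rw [qPochInf_eq_zero hn]
      simp

lemma one_sub_exp_two_pi_eq_zero_iff (x : ℂ) :
    1 - Complex.exp (2 * π * I * x) = 0 ↔ ∃ n : ℤ, x = n := by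
  rw [sub_eq_zero, eq_comm, Complex.exp_eq_one_iff]
  refine exists_congr fun n => ?_
  rw [mul_comm (n : ℂ), mul_right_inj' Complex.two_pi_I_ne_zero]

lemma oddTheta_eq_zero_iff_mem (u : ℂ) {t : ℂ} (ht : 0 < t.im) :
    oddTheta u t = 0 ↔ u ∈ latticeSet (2 * t) := by
  rw [oddTheta_eq_zero_iff u ht]
  simp only [one_sub_exp_two_pi_eq_zero_iff]
  constructor
  · rintro ⟨n, m, h⟩
    exact ⟨-n, m, by push_cast; linear_combination h⟩
  · rintro ⟨n, m, h⟩
    exact ⟨-n, m, by push_cast; linear_combination h⟩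

lemma regular_of_notMem {u t : ℂ} (ht : 0 < t.im) (hu : u ∉ latticeSet (2 * t)) (n : ℤ) :
    1 - Complex.exp (2 * π * I * (u + 2 * n * t)) ≠ 0 := fun h =>
  hu ((oddTheta_eq_zero_iff_mem u ht).1 ((oddTheta_eq_zero_iff u ht).2 ⟨n, h⟩))

lemma jacobiTheta₂_eq_jTheta (u t : ℂ) : Complex.exp (π * I * u) * Complex.exp (π * I * t / 2) *
    jTheta (u + 1 / 2 + t) (2 * t) = -jacobiTheta₂ u (2 * t) := by
  rw [jTheta_eq_jacobiTheta₂, show u + 1 / 2 + t + 1 / 2 + 2 * t / 2 = u + 2 * t + 1 by ring,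
    jacobiTheta₂_add_left, jacobiTheta₂_add_left']
  have h : Complex.exp (π * I * u) * Complex.exp (π * I * t / 2) *
      (I * Complex.exp (π * I * (2 * t) / 4) * (Complex.exp (π * I * (u + 1 / 2 + t)) *
        Complex.exp (-π * I * (2 * t + 2 * u)))) = -1 := by
    rw [← Complex.exp_pi_mul_I]
    conv_lhs => rw [show (I : ℂ) * Complex.exp (π * I * (2 * t) / 4) =
      Complex.exp (π / 2 * I + π * I * (2 * t) / 4) by
        rw [Complex.exp_add, Complex.exp_pi_div_two_mul_I]]
    rw [← Complex.exp_add, ← Complex.exp_add, ← Complex.exp_add, ← Complex.exp_add]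
    congr 1
    ring
  linear_combination jacobiTheta₂ u (2 * t) * h

lemma jacobiTheta₂_zero_eq {t : ℂ} (ht : 0 < t.im) : jacobiTheta₂ 0 (2 * t) =
    qPochInf (Complex.exp (2 * π * I * t) ^ 2) (Complex.exp (2 * π * I * t) ^ 2) *
      qPochInf (-Complex.exp (2 * π * I * t)) (Complex.exp (2 * π * I * t) ^ 2) ^ 2 := by
  rw [jacobiTheta₂_eq_qPochInf _ (two_mul_im_pos ht),
    show (π : ℂ) * I * (2 * t) = 2 * π * I * t by ring]
  simp only [mul_zero, Complex.exp_zero, inv_one, one_mul]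
  ring

lemma dedekindEta_eq (t : ℂ) : dedekindEta t = Complex.exp (π * I * t / 12) *
    qPochInf (Complex.exp (2 * π * I * t)) (Complex.exp (2 * π * I * t)) := by
  rw [dedekindEta, qPochInf]
  congr 1
  refine tprod_congr fun n => ?_
  rw [← Complex.exp_nat_mul, ← Complex.exp_add]
  congr 2
  ring

lemma eta_product_eq {t : ℂ} (ht : 0 < t.im) :
    dedekindEta t * dedekindEta (2 * t) ^ 5 * dedekindEta (4 * t) * jacobiTheta₂ 0 (2 * t) *
      appellSum 0 0 t t = -(Complex.exp (π * I * t / 2) ^ 3 *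
        qPochInf (Complex.exp (2 * π * I * t) ^ 2) (Complex.exp (2 * π * I * t) ^ 2) ^ 9) := by
  have e2 : Complex.exp (2 * π * I * (2 * t)) = Complex.exp (2 * π * I * t) ^ 2 := by
    rw [← Complex.exp_nat_mul]; congr 1; push_cast; ring
  have e4 : Complex.exp (2 * π * I * (4 * t)) = Complex.exp (2 * π * I * t) ^ 4 := by
    rw [← Complex.exp_nat_mul]; congr 1; push_cast; ring
  have ee : Complex.exp (π * I * t / 12) * Complex.exp (π * I * (2 * t) / 12) ^ 5 *
      Complex.exp (π * I * (4 * t) / 12) * Complex.exp (π * I * t / 4) =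
      Complex.exp (π * I * t / 2) ^ 3 := by
    simp only [← Complex.exp_nat_mul, ← Complex.exp_add]
    congr 1
    push_cast
    ring
  rw [dedekindEta_eq, dedekindEta_eq, dedekindEta_eq, jacobiTheta₂_zero_eq ht,
    appellSum_zero_zero t ht, e2, e4, ← ee]
  have hq := norm_exp_two_pi_mul_I_lt_one ht
  generalize Complex.exp (2 * π * I * t) = q at *
  have hq2 : ‖q ^ 2‖ < 1 := by
    rw [norm_pow]; exact pow_lt_one₀ (norm_nonneg _) hq (by norm_num)
  have p1 : qPochInf q q = qPochInf q (q ^ 2) * qPochInf (q ^ 2) (q ^ 2) := by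
    have := qPochInf_even_mul_odd hq q
    rwa [← sq] at this
  have p2 : qPochInf (q ^ 2) (q ^ 2) = qPochInf (q ^ 2) (q ^ 4) * qPochInf (q ^ 4) (q ^ 4) := by
    have := qPochInf_even_mul_odd hq2 (q ^ 2)
    rwa [← sq, ← pow_mul] at this
  have p3 : qPochInf q (q ^ 2) * qPochInf (-q) (q ^ 2) = qPochInf (q ^ 2) (q ^ 4) := by
    have := qPochInf_mul_neg hq2 q
    rwa [← pow_mul] at this
  rw [p1]
  rw [← p3] at p2
  generalize qPochInf (q ^ 2) (q ^ 2) = P at *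
  generalize qPochInf q (q ^ 2) = O at *
  generalize qPochInf (-q) (q ^ 2) = N at *
  generalize qPochInf (q ^ 4) (q ^ 4) = R at *
  subst p2
  ring

/-- The theta function `oddTheta` divided by `1 - z⁻¹`, where `z = exp (2 * π * I * u)`. -/
def oddThetaQuot (u t : ℂ) : ℂ :=
  Complex.exp (π * I * u) *
      (qPochInf (Complex.exp (2 * π * I * t) ^ 2) (Complex.exp (2 * π * I * t) ^ 2) *
        (qPochInf (Complex.exp (2 * π * I * u) * Complex.exp (2 * π * I * t) ^ 2)
            (Complex.exp (2 * π * I * t) ^ 2) *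
          qPochInf ((Complex.exp (2 * π * I * u))⁻¹ * Complex.exp (2 * π * I * t) ^ 2)
            (Complex.exp (2 * π * I * t) ^ 2)))

lemma oddTheta_eq_mul_oddThetaQuot (u : ℂ) {t : ℂ} (ht : 0 < t.im) :
    oddTheta u t = (1 - (Complex.exp (2 * π * I * u))⁻¹) * oddThetaQuot u t := by
  rw [oddTheta_eq u ht, oddThetaQuot]
  ring

lemma norm_exp_sq_lt_one {t : ℂ} (ht : 0 < t.im) : ‖Complex.exp (2 * π * I * t) ^ 2‖ < 1 := by
  rw [norm_pow]
  exact pow_lt_one₀ (norm_nonneg _) (norm_exp_two_pi_mul_I_lt_one ht) two_ne_zero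

lemma continuous_oddThetaQuot {t : ℂ} (ht : 0 < t.im) : Continuous fun u => oddThetaQuot u t := by
  have h := continuous_qPochInf (norm_exp_sq_lt_one ht)
  have h1 : Continuous fun u : ℂ => Complex.exp (2 * π * I * u) * Complex.exp (2 * π * I * t) ^ 2 := by
    fun_prop
  have h2 : Continuous fun u : ℂ =>
      (Complex.exp (2 * π * I * u))⁻¹ * Complex.exp (2 * π * I * t) ^ 2 := by
    simp only [← Complex.exp_neg]
    fun_prop
  have h3 : Continuous fun u : ℂ => Complex.exp (π * I * u) := by fun_prop
  exact h3.mul (continuous_const.mul ((h.comp h1).mul (h.comp h2)))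

lemma oddThetaQuot_zero (t : ℂ) : oddThetaQuot 0 t =
    qPochInf (Complex.exp (2 * π * I * t) ^ 2) (Complex.exp (2 * π * I * t) ^ 2) ^ 3 := by
  simp only [oddThetaQuot, mul_zero, Complex.exp_zero, inv_one, one_mul]
  ring

lemma tendsto_oddTheta_mul_poleTerm {t : ℂ} (ht : 0 < t.im) :
    Tendsto (fun u => oddTheta u t * poleTerm 0 u t) (nhdsWithin 0 {0}ᶜ)
      (nhds (-(qPochInf (Complex.exp (2 * π * I * t) ^ 2) (Complex.exp (2 * π * I * t) ^ 2) ^ 3))) := by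
  have hc : Continuous fun u : ℂ => -((Complex.exp (2 * π * I * u))⁻¹ * oddThetaQuot u t) := by
    refine (Continuous.mul ?_ (continuous_oddThetaQuot ht)).neg
    simp only [← Complex.exp_neg]
    fun_prop
  have h := hc.tendsto 0
  simp only [mul_zero, Complex.exp_zero, inv_one, one_mul, oddThetaQuot_zero] at h
  refine (h.mono_left nhdsWithin_le_nhds).congr' ?_
  filter_upwards [eventually_notMem_latticeSet (differentiable_oddTheta ht)
    (fun u => oddTheta_eq_zero_iff_mem u ht) 0] with u hu
  have h0 := regular_of_notMem ht hu 0
  rw [oddTheta_eq_mul_oddThetaQuot u ht, poleTerm]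
  rw [Int.cast_zero, mul_zero, zero_mul, add_zero] at *
  have hz := Complex.exp_ne_zero (2 * π * I * u)
  generalize Complex.exp (2 * π * I * u) = z at *
  field_simp
  ring

lemma tendsto_div_oddTheta {t : ℂ} (ht : 0 < t.im) : ∃ c,
    Tendsto (fun u => u / oddTheta u t) (nhdsWithin 0 {0}ᶜ) (nhds c) := by
  have hG : oddThetaQuot 0 t ≠ 0 := by
    rw [oddThetaQuot_zero]
    exact pow_ne_zero 3 (qPochInf_self_ne_zero (norm_exp_sq_lt_one ht))
  have h1 : HasDerivAt (fun u : ℂ => 1 - Complex.exp (-(2 * π * I * u))) (2 * π * I) 0 := by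
    have : HasDerivAt (fun u : ℂ => -(2 * π * I * u)) (-(2 * π * I)) 0 := by
      simpa using ((hasDerivAt_id (0 : ℂ)).const_mul (2 * π * I)).fun_neg
    simpa using this.cexp.const_sub 1
  have h2 := hasDerivAt_iff_tendsto_slope.1 h1
  have h3 := (((continuous_oddThetaQuot ht).tendsto 0).mono_left
    (nhdsWithin_le_nhds (s := {0}ᶜ))).mul h2
  refine ⟨_, (h3.inv₀ (mul_ne_zero hG Complex.two_pi_I_ne_zero)).congr fun u => ?_⟩
  rw [oddTheta_eq_mul_oddThetaQuot u ht, slope_def_field, ← Complex.exp_neg]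
  simp only [mul_zero, neg_zero, Complex.exp_zero, sub_self, sub_zero, mul_inv, div_eq_mul_inv,
    inv_inv]
  ring

lemma exists_norm_appellSum_sub_le (k j : ℕ) {t : ℂ} (ht : 0 < t.im) :
    ∃ C, ∀ᶠ u in nhdsWithin 0 {0}ᶜ, ‖appellSum k j u t - appellTerm k j 0 u t‖ ≤ C := by
  have hs (n : ℤ) (hn : n ∈ ({0}ᶜ : Set ℤ)) :
      1 - Complex.exp (2 * π * I * (0 + 2 * n * t)) ≠ 0 := by
    rw [Ne, one_sub_exp_two_pi_eq_zero_iff]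
    rintro ⟨m, hm⟩
    have h2 := congrArg Complex.im hm
    rw [show 0 + 2 * (n : ℂ) * t = ((2 * n : ℝ) : ℂ) * t by push_cast; ring,
      Complex.im_ofReal_mul, Complex.intCast_im] at h2
    rcases mul_eq_zero.1 h2 with h4 | h4
    · exact hn (by simpa using h4)
    · exact ht.ne' h4
  obtain ⟨b, hb, hle⟩ := exists_norm_appellTerm_le k j ht _ hs
  have hc : Tendsto (fun w : ℂ => (w, t)) (nhdsWithin 0 {0}ᶜ) (nhds (0, t)) :=
    (Continuous.tendsto (by fun_prop) 0).mono_left nhdsWithin_le_nhds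
  refine ⟨∑' n, |b n|, ?_⟩
  filter_upwards [hc.eventually hle, eventually_notMem_latticeSet (differentiable_oddTheta ht)
    (fun u => oddTheta_eq_zero_iff_mem u ht) 0] with u h1 h2
  rw [appellSum, (summable_appellTerm k j ht (regular_of_notMem ht h2)).tsum_eq_add_tsum_ite 0,
    add_sub_cancel_left]
  refine tsum_of_norm_bounded hb.abs.hasSum fun n => ?_
  split_ifs with hn
  · simp
  · exact (h1 n hn).2.trans (le_abs_self _)

lemma tendsto_oddTheta_zero {t : ℂ} (ht : 0 < t.im) :
    Tendsto (fun u => oddTheta u t) (nhdsWithin 0 {0}ᶜ) (nhds 0) := by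
  have h := ((differentiable_oddTheta ht).continuous.tendsto 0).mono_left
    (nhdsWithin_le_nhds (s := {0}ᶜ))
  rwa [(oddTheta_eq_zero_iff_mem 0 ht).2 ⟨0, 0, by simp⟩] at h

lemma tendsto_oddTheta_pow_mul_appellSum (k : ℕ) {j : ℕ} (hj : j ≤ 3) {t : ℂ} (ht : 0 < t.im) :
    Tendsto (fun u => oddTheta u t ^ 3 * appellSum k j u t) (nhdsWithin 0 {0}ᶜ)
      (nhds ((3 / 2) ^ k * Complex.exp (9 * π * I * t / 4) * 0 ^ (3 - j) *
        (-(qPochInf (Complex.exp (2 * π * I * t) ^ 2) (Complex.exp (2 * π * I * t) ^ 2) ^ 3)) ^ j)) := by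
  obtain ⟨C, hC⟩ := exists_norm_appellSum_sub_le k j ht
  have h0 := tendsto_oddTheta_zero ht
  have h1 : Tendsto (fun u => oddTheta u t ^ 3 * (appellSum k j u t - appellTerm k j 0 u t))
      (nhdsWithin 0 {0}ᶜ) (nhds 0) := by
    refine Tendsto.zero_mul_isBoundedUnder_le ?_ ⟨C, by simpa using hC⟩
    simpa using h0.pow 3
  have h2 := ((h0.pow (3 - j)).mul ((tendsto_oddTheta_mul_poleTerm ht).pow j)).const_mul
    ((3 / 2) ^ k * Complex.exp (9 * π * I * t / 4))
  have h3 := h1.add h2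
  rw [zero_add, ← mul_assoc] at h3
  refine h3.congr fun u => ?_
  have e : oddTheta u t ^ 3 = oddTheta u t ^ (3 - j) * oddTheta u t ^ j := by
    rw [← pow_add, Nat.sub_add_cancel hj]
  rw [appellTerm, mul_pow, Int.cast_zero, mul_zero, zero_add, zpow_zero, one_mul,
    show π * I * (3 / 2) ^ 2 * t = 9 * π * I * t / 4 by ring]
  linear_combination (-((3 / 2) ^ k * Complex.exp (9 * π * I * t / 4) * poleTerm 0 u t ^ j)) * e

lemma tendsto_oddTheta_pow_mul_bracketHeat {t : ℂ} (ht : 0 < t.im) :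
    Tendsto (fun u => oddTheta u t ^ 3 * bracketHeat u t) (nhdsWithin 0 {0}ᶜ)
      (nhds (8 * π ^ 2 / (I * appellSum 0 0 t t) *
        qPochInf (Complex.exp (2 * π * I * t) ^ 2) (Complex.exp (2 * π * I * t) ^ 2) ^ 9)) := by
  have hs (k : ℕ) {j : ℕ} (hj : j ≤ 3) := tendsto_oddTheta_pow_mul_appellSum k hj ht
  have hE : Tendsto (fun u => -4 * π ^ 2 * Complex.exp (3 * π * I * u - 9 * π * I * t / 4) /
      (I * appellSum 0 0 t t)) (nhdsWithin 0 {0}ᶜ)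
      (nhds (-4 * π ^ 2 * Complex.exp (3 * π * I * 0 - 9 * π * I * t / 4) /
      (I * appellSum 0 0 t t))) :=
    Tendsto.mono_left (Continuous.tendsto (f := fun u : ℂ => -4 * π ^ 2 *
      Complex.exp (3 * π * I * u - 9 * π * I * t / 4) / (I * appellSum 0 0 t t)) (by fun_prop) 0)
      nhdsWithin_le_nhds
  have h := hE.mul ((((hs 2 (j := 1) (by norm_num)).add
    (((hs 1 (j := 2) (by norm_num)).sub (hs 1 (j := 1) (by norm_num))).const_mul 2)).add
    ((((hs 0 (j := 3) le_rfl).const_mul 2).sub ((hs 0 (j := 2) (by norm_num)).const_mul 3)).add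
    (hs 0 (j := 1) (by norm_num)))).sub ((hs 0 (j := 1) (by norm_num)).const_mul
      (appellSum 2 0 t t / appellSum 0 0 t t)))
  have e : Complex.exp (3 * π * I * 0 - 9 * π * I * t / 4) * Complex.exp (9 * π * I * t / 4) = 1 := by
    rw [← Complex.exp_add]
    simp
  refine (h.congr fun u => ?_).trans_eq ?_
  · rw [bracketHeat, appellHeat, appellSum_zero_right 0 u t, appellSum_zero_right 2 u t]
    ring
  · congr 1
    rw [mul_zero, zero_sub] at e
    norm_num
    linear_combination (8 * π ^ 2 / (I * appellSum 0 0 t t) *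
      qPochInf (Complex.exp (2 * π * I * t) ^ 2) (Complex.exp (2 * π * I * t) ^ 2) ^ 9) * e

lemma differentiableAt_bracketHeat {u t : ℂ} (ht : 0 < t.im)
    (h : ∀ n : ℤ, 1 - Complex.exp (2 * π * I * (u + 2 * n * t)) ≠ 0) :
    DifferentiableAt ℂ (fun w => bracketHeat w t) u := by
  have hs (k j : ℕ) : DifferentiableAt ℂ (fun w => appellSum k j w t) u :=
    (hasDerivAt_appellSum_fst k j ht h).differentiableAt
  have hL := appellSum_zero_zero_ne_zero u ht
  have s21 := hs 2 1
  have s12 := hs 1 2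
  have s11 := hs 1 1
  have s03 := hs 0 3
  have s02 := hs 0 2
  have s01 := hs 0 1
  have s00 := hs 0 0
  have s20 := hs 2 0
  have hL' : I * appellSum 0 0 u t ≠ 0 := mul_ne_zero Complex.I_ne_zero hL
  unfold bracketHeat appellHeat
  fun_prop (disch := assumption)

/-- The constant on the theta side of the heat equation. -/
def etaConst (t : ℂ) : ℂ :=
  8 * π ^ 2 * (dedekindEta t * dedekindEta (2 * t) ^ 5 * dedekindEta (4 * t))

/-- The quotient by `oddTheta` of the difference of the two sides of the heat equation. -/
def heatDefect (u t : ℂ) : ℂ :=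
  (I * Complex.exp (π * I * t / 2)) ^ 3 * oddTheta u t ^ 2 * bracketHeat u t -
    etaConst t * jacobiTheta₂ u (2 * t) / oddTheta u t

lemma heatDefect_eq_zero {u t : ℂ} (ht : 0 < t.im) (hu : u ∉ latticeSet (2 * t)) :
    heatDefect u t = 0 := by
  have hz (u : ℂ) := oddTheta_eq_zero_iff_mem u ht
  have hJ (u : ℂ) : DifferentiableAt ℂ (fun w => jacobiTheta₂ w (2 * t)) u :=
    differentiableAt_jacobiTheta₂_fst u (two_mul_im_pos ht)
  refine eq_zero_of_antiperiodic (two_mul_im_pos ht) (Θ := fun u => oddTheta u t)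
    (d := fun u => heatDefect u t) (differentiable_oddTheta ht) hz
    (fun v hv => ?_) (fun v hv => ?_) (fun v hv => ?_) ?_ hu
  · have h1 := differentiableAt_bracketHeat ht (regular_of_notMem ht hv)
    have h2 := differentiable_oddTheta ht v
    have h3 := hJ v
    have h4 : oddTheta v t ≠ 0 := (hz v).not.2 hv
    unfold heatDefect
    fun_prop (disch := assumption)
  · simp only [heatDefect, oddTheta_add_one, bracketHeat_add_one, jacobiTheta₂_add_left]
    ring
  · have e : Complex.exp (-π * I * (2 * t + 2 * v)) =
        (Complex.exp (2 * π * I * t))⁻¹ * (Complex.exp (2 * π * I * v))⁻¹ := by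
      rw [← Complex.exp_neg, ← Complex.exp_neg, ← Complex.exp_add]
      congr 1
      ring
    have h4 : oddTheta v t ≠ 0 := (hz v).not.2 hv
    have h5 := Complex.exp_ne_zero (2 * π * I * t)
    have h6 := Complex.exp_ne_zero (2 * π * I * v)
    simp only [heatDefect, oddTheta_add_two_mul, jacobiTheta₂_add_left', e,
      bracketHeat_add_two_mul ht (regular_of_notMem ht hv)]
    field_simp
    ring
  · obtain ⟨c, hc⟩ := tendsto_div_oddTheta ht
    have h1 := (tendsto_oddTheta_pow_mul_bracketHeat ht).const_mul
      ((I * Complex.exp (π * I * t / 2)) ^ 3)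
    have h2 := ((hJ 0).continuousAt.tendsto.mono_left (nhdsWithin_le_nhds (s := {0}ᶜ))).const_mul
      (etaConst t)
    have h3 := hc.mul (h1.sub h2)
    have hval : (I * Complex.exp (π * I * t / 2)) ^ 3 * (8 * π ^ 2 / (I * appellSum 0 0 t t) *
        qPochInf (Complex.exp (2 * π * I * t) ^ 2) (Complex.exp (2 * π * I * t) ^ 2) ^ 9) -
        etaConst t * jacobiTheta₂ 0 (2 * t) = 0 := by
      have hL := appellSum_zero_zero_ne_zero t ht
      have he := eta_product_eq ht
      have hI := Complex.I_ne_zero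
      rw [etaConst]
      clear h1 h2 h3
      generalize dedekindEta (2 * t) = e2 at *
      generalize dedekindEta (4 * t) = e4 at *
      generalize jacobiTheta₂ 0 (2 * t) = j at *
      generalize Complex.exp (π * I * t / 2) = r at *
      generalize qPochInf (Complex.exp (2 * π * I * t) ^ 2) (Complex.exp (2 * π * I * t) ^ 2) = p
        at *
      field_simp
      rw [Complex.I_sq]
      linear_combination (-8 * π ^ 2 : ℂ) * he
    rw [hval, mul_zero] at h3
    refine h3.congr' ?_
    filter_upwards [eventually_notMem_latticeSet (differentiable_oddTheta ht) hz 0] with v hv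
    have h4 : oddTheta v t ≠ 0 := (hz v).not.2 hv
    rw [heatDefect]
    field_simp

lemma heat_equation {u t : ℂ} (ht : 0 < t.im)
    (hu : ∀ m n : ℤ, u ≠ 2 * (m : ℂ) * t + (n : ℂ) / 2) :
    jTheta u (2 * t) ^ 3 * (4 * π * I * deriv (fun s => lerchBracket u s) t +
        iteratedDeriv 2 (fun w => lerchBracket w t) u) =
      -8 * π ^ 2 * dedekindEta t * dedekindEta (2 * t) ^ 5 * dedekindEta (4 * t) *
        Complex.exp (π * I * u) * Complex.exp (π * I * t / 2) *
        jTheta (u + 1 / 2 + t) (2 * t) := by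
  have hmem : u ∉ latticeSet (2 * t) := by
    rintro ⟨m, n, h⟩
    exact hu m (2 * n) (by push_cast; linear_combination h)
  have hreg (n : ℤ) : 1 - Complex.exp (2 * π * I * (2 * u + 2 * n * (2 * t))) ≠ 0 := by
    rw [Ne, one_sub_exp_two_pi_eq_zero_iff]
    rintro ⟨m, h⟩
    exact hu (-n) m (by push_cast; linear_combination h / 2)
  have h0 := heatDefect_eq_zero ht hmem
  have hΘ : oddTheta u t ≠ 0 := (oddTheta_eq_zero_iff_mem u ht).not.2 hmem
  rw [heatDefect, etaConst, sub_eq_zero, eq_div_iff hΘ] at h0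
  rw [heat_lerchBracket ht hreg, jTheta_two_mul]
  linear_combination h0 + 8 * π ^ 2 * dedekindEta t * dedekindEta (2 * t) ^ 5 *
    dedekindEta (4 * t) * jacobiTheta₂_eq_jTheta u t

/-- The heat-operator form of the PDE for the M2-rank for partitions without
repeated odd parts. -/
theorem m2_pde_heat (τ u : ℂ) (hτ : 0 < τ.im)
    (hu : ∀ m n : ℤ, u ≠ 2 * (m : ℂ) * τ + (n : ℂ) / 2) :
    jTheta u (2 * τ) ^ 3 *
      (4 * π * I * deriv (fun t : ℂ =>
          Complex.exp (π * I * u) * Complex.exp (-π * I * t / 4) * lerchMu (2 * u) t (4 * t)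
            + Complex.exp (-9 * π * I * t / 4) * Complex.exp (3 * π * I * u) *
                lerchMu (2 * u) (3 * t) (4 * t)) τ
        + iteratedDeriv 2 (fun w : ℂ =>
          Complex.exp (π * I * w) * Complex.exp (-π * I * τ / 4) * lerchMu (2 * w) τ (4 * τ)
            + Complex.exp (-9 * π * I * τ / 4) * Complex.exp (3 * π * I * w) *
                lerchMu (2 * w) (3 * τ) (4 * τ)) u)
    = -8 * π^2 * dedekindEta τ * dedekindEta (2 * τ) ^ 5 * dedekindEta (4 * τ) *
        Complex.exp (π * I * u) * Complex.exp (π * I * τ / 2) *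
        jTheta (u + 1/2 + τ) (2 * τ) :=
  heat_equation hτ hu

end
end
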